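/- arXiv:1807.07241 — 15 statements merged into one kernel-verified Lean document; each statement's English description precedes it below -/
import Mathlib

section
/- Let r ≥ 0, s > 0 and n > 0 be integers. Let χ₁, …, χ_s be Dirichlet characters modulo n with conductors d₁, …, d_s, let d = lcm(d₁, …, d_s), and let n₀ be the largest divisor of n such that n₀ and d have exactly the same prime factors. Then ∑ gcd(a₁−1, …, a_s−1, b₁, …, b_r, n)·χ₁(a₁)⋯χ_s(a_s), where a₁, …, a_s range over integers in [1,n] coprime to n and b₁, …, b_r range over integers in [1,n], equals φ(n)·σ_{s+r−1}(n₀/d)·∏_{p^m ∥ n/n₀} (φ(p^m)^{s−1}·p^{mr} + σ_{s+r−1}(p^m) − p^{m(s+r−1)}), where the product is over prime powers p^m exactly dividing n/n₀. -/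
open Finset

lemma ms_sum_divisors_mul {m k : ℕ} (h : m.Coprime k) (f : ℕ → ℂ) :
    ∑ e ∈ (m * k).divisors, f e = ∑ x ∈ m.divisors, ∑ y ∈ k.divisors, f (x * y) := by
  classical
  rw [← Finset.sum_product', Nat.divisors_mul, ← Finset.image_mul_product,
    Finset.sum_image h.mul_injOn_divisors]

lemma ms_totient_same {a b : ℕ} (h : a.primeFactors = b.primeFactors) :
    a.totient * b = b.totient * a := by
  have h1 := Nat.totient_mul_prod_primeFactors a
  have h2 := Nat.totient_mul_prod_primeFactors b
  rw [h] at h1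
  have hpos : 0 < ∏ p ∈ b.primeFactors, p :=
    Finset.prod_pos fun p hp => (Nat.prime_of_mem_primeFactors hp).pos
  apply Nat.eq_of_mul_eq_mul_right hpos
  calc _ = (a.totient * ∏ p ∈ b.primeFactors, p) * b := by ring
    _ = (b.totient * ∏ p ∈ b.primeFactors, p) * a := by rw [h1, h2]; ring
    _ = _ := by ring

/-- divisor sum -/
noncomputable def msG (u r m : ℕ) : ℂ :=
  ∑ e ∈ m.divisors, ((m.totient : ℂ) / e.totient) ^ u * ((m : ℂ) / e) ^ r

lemma msG_mul (u r m k : ℕ) (h : m.Coprime k) : msG u r (m * k) = msG u r m * msG u r k := by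
  unfold msG
  rw [ms_sum_divisors_mul h, Finset.sum_mul_sum]
  refine Finset.sum_congr rfl fun x hx => Finset.sum_congr rfl fun y hy => ?_
  have hxy : x.Coprime y := Nat.Coprime.of_dvd (Nat.dvd_of_mem_divisors hx)
    (Nat.dvd_of_mem_divisors hy) h
  rw [Nat.totient_mul h, Nat.totient_mul hxy]
  push_cast
  rw [mul_div_mul_comm, mul_div_mul_comm, mul_pow, mul_pow]
  ring

lemma msG_prime_pow (u r p k : ℕ) (hp : p.Prime) (hk : 0 < k) :
    msG u r (p ^ k) = ((p ^ k).totient : ℂ) ^ u * (p : ℂ) ^ (k * r) +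
      (∑ e ∈ (p ^ k).divisors, (e : ℂ) ^ (u + r)) - (p : ℂ) ^ (k * (u + r)) := by
  have hp0 : (p : ℂ) ≠ 0 := by exact_mod_cast hp.ne_zero
  have hp1 : ((p - 1 : ℕ) : ℂ) ≠ 0 := by
    have := hp.two_le
    exact_mod_cast (by omega : p - 1 ≠ 0)
  unfold msG
  rw [Nat.sum_divisors_prime_pow hp, Nat.sum_divisors_prime_pow hp, Finset.sum_range_succ',
    Finset.sum_range_succ]
  have : ∑ j ∈ range k, (((p ^ k).totient : ℂ) / ((p ^ (j + 1)).totient : ℕ)) ^ u *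
      (((p ^ k : ℕ) : ℂ) / ((p ^ (j + 1) : ℕ) : ℂ)) ^ r
      = ∑ j ∈ range k, (((p ^ j : ℕ) : ℂ)) ^ (u + r) := by
    rw [← Finset.sum_range_reflect (fun j => (((p ^ j : ℕ) : ℂ)) ^ (u + r))]
    refine Finset.sum_congr rfl fun j hj => ?_
    have hj := Finset.mem_range.1 hj
    obtain ⟨i, rfl⟩ : ∃ i, k = j + 1 + i := ⟨k - (j + 1), by omega⟩
    have e1 : j + 1 + i - 1 - j = i := by omega
    have e2 : j + 1 + i = (j + i) + 1 := by omega
    rw [e1, pow_add _ u r]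
    congr 2
    · rw [e2, Nat.totient_prime_pow_succ hp, Nat.totient_prime_pow_succ hp]
      push_cast [pow_add]
      field_simp
    · push_cast [pow_add]
      field_simp
  rw [this]
  simp [← pow_mul]
  ring

lemma msG_eq_prod (u r m : ℕ) (hm : m ≠ 0) : msG u r m = ∏ p ∈ m.primeFactors,
        ((Nat.totient (p ^ m.factorization p) : ℂ) ^ u *
            (p : ℂ) ^ (m.factorization p * r) +
          (∑ e ∈ (p ^ m.factorization p).divisors, (e : ℂ) ^ (u + r)) -
          (p : ℂ) ^ (m.factorization p * (u + r))) := by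
  rw [Nat.multiplicative_factorization (msG u r) (msG_mul u r) (by simp [msG]) hm]
  rw [Finsupp.prod, Nat.support_factorization]
  refine Finset.prod_congr rfl fun p hp => msG_prime_pow u r p _ (Nat.prime_of_mem_primeFactors hp) ?_
  exact (Nat.prime_of_mem_primeFactors hp).factorization_pos_of_dvd hm (Nat.dvd_of_mem_primeFactors hp)

/-- the sum over `D ∣ e ∣ n₀` when `n₀` and `D` have the same primes -/
lemma ms_first (u r n₀ D : ℕ) (h0 : n₀ ≠ 0) (hD : D ∣ n₀) (hpf : n₀.primeFactors = D.primeFactors) :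
    ∑ e ∈ n₀.divisors with D ∣ e, ((n₀.totient : ℂ) / e.totient) ^ u * ((n₀ : ℂ) / e) ^ r
      = ∑ e ∈ (n₀ / D).divisors, (e : ℂ) ^ (u + r) := by
  obtain ⟨k, rfl⟩ := hD
  have hD0 : D ≠ 0 := left_ne_zero_of_mul h0
  have hk0 : k ≠ 0 := right_ne_zero_of_mul h0
  rw [Nat.mul_div_cancel_left k (Nat.pos_of_ne_zero hD0)]
  rw [← Nat.sum_div_divisors k]
  symm
  refine Finset.sum_bij (fun f _ => D * f) ?_ ?_ ?_ ?_
  · intro f hf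
    have := Nat.dvd_of_mem_divisors hf
    simp [hD0, hk0, mul_dvd_mul_left D this]
  · intro a _ b _ hab
    exact Nat.eq_of_mul_eq_mul_left (Nat.pos_of_ne_zero hD0) hab
  · intro e he
    simp only [mem_filter, Nat.mem_divisors] at he
    obtain ⟨⟨h1, h2⟩, f, rfl⟩ := he
    exact ⟨f, by simp [hk0, Nat.dvd_of_mul_dvd_mul_left (Nat.pos_of_ne_zero hD0) h1], rfl⟩
  · intro f hf
    obtain ⟨g, rfl⟩ := Nat.dvd_of_mem_divisors hf
    have hf0 : f ≠ 0 := left_ne_zero_of_mul hk0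
    have hg0 : g ≠ 0 := right_ne_zero_of_mul hk0
    rw [Nat.mul_div_cancel_left g (Nat.pos_of_ne_zero hf0)]
    have hpf2 : (D * (f * g)).primeFactors = (D * f).primeFactors := by
      apply le_antisymm
      · rw [hpf]
        exact Nat.primeFactors_mono (Dvd.intro _ rfl) (mul_ne_zero hD0 hf0)
      · exact Nat.primeFactors_mono ⟨g, by ring⟩ h0
    have ht := ms_totient_same hpf2
    have hDf : ((D * f).totient : ℂ) ≠ 0 := by
      simp [hD0, hf0]
    have hDc : (D : ℂ) ≠ 0 := by exact_mod_cast hD0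
    have hfc : (f : ℂ) ≠ 0 := by exact_mod_cast hf0
    have htc : ((D * (f * g)).totient : ℂ) * (D * f) = (D * f).totient * (D * (f * g)) := by
      exact_mod_cast ht
    have e1 : ((D * (f * g)).totient : ℂ) / (D * f).totient = g := by
      rw [div_eq_iff hDf]
      apply mul_right_cancel₀ (mul_ne_zero hDc hfc)
      rw [htc]; ring
    have e2 : ((D * (f * g) : ℕ) : ℂ) / (D * f : ℕ) = g := by
      push_cast; field_simp
    rw [e1, e2, pow_add]

lemma ms_divsum (u r n₀ m D : ℕ) (h0 : n₀ ≠ 0) (hco : n₀.Coprime m)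
    (hD : D ∣ n₀) (hpf : n₀.primeFactors = D.primeFactors) :
    ∑ e ∈ (n₀ * m).divisors with D ∣ e,
      (((n₀ * m).totient : ℂ) / e.totient) ^ u * (((n₀ * m : ℕ) : ℂ) / e) ^ r
      = (∑ e ∈ (n₀ / D).divisors, (e : ℂ) ^ (u + r)) * msG u r m := by
  rw [← ms_first u r n₀ D h0 hD hpf, Finset.sum_filter, ms_sum_divisors_mul hco,
    Finset.sum_filter, msG, Finset.sum_mul_sum]
  refine Finset.sum_congr rfl fun x hx => Finset.sum_congr rfl fun y hy => ?_
  have hx' := Nat.dvd_of_mem_divisors hx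
  have hy' := Nat.dvd_of_mem_divisors hy
  have hxy : x.Coprime y := Nat.Coprime.of_dvd hx' hy' hco
  have hDy : D.Coprime y := Nat.Coprime.of_dvd hD hy' hco
  have : D ∣ x * y ↔ D ∣ x := ⟨hDy.dvd_of_dvd_mul_right, fun h => h.mul_right y⟩
  simp only [this]
  split_ifs
  · rw [Nat.totient_mul hco, Nat.totient_mul hxy]
    push_cast
    rw [mul_div_mul_comm, mul_div_mul_comm, mul_pow, mul_pow]
    ring
  · simp

lemma ms_charsum (n : ℕ) (hn : 0 < n) (χ : DirichletCharacter ℂ n) (e : ℕ) (he : e ∣ n) :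
    ∑ a ∈ (Finset.Icc 1 n).filter (fun x => Nat.Coprime x n),
      (if e ∣ a - 1 then χ (a : ZMod n) else 0)
    = if χ.conductor ∣ e then (n.totient : ℂ) / e.totient else 0 := by
  classical
  have : NeZero n := ⟨hn.ne'⟩
  have : NeZero e := ⟨fun h => by subst h; exact hn.ne' (Nat.eq_zero_of_zero_dvd he)⟩
  have step1 : ∑ a ∈ (Finset.Icc 1 n).filter (fun x => Nat.Coprime x n),
      (if e ∣ a - 1 then χ (a : ZMod n) else 0)
      = ∑ v : (ZMod n)ˣ, if v ∈ (ZMod.unitsMap he).ker then χ v else 0 := by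
    refine Finset.sum_bij (fun a ha => ZMod.unitOfCoprime a (Finset.mem_filter.1 ha).2) ?_ ?_ ?_ ?_
    · intros; simp
    · intro a ha b hb hab
      simp only [mem_filter, mem_Icc] at ha hb
      have h1 := congrArg (fun v : (ZMod n)ˣ => (v : ZMod n)) hab
      simp only [ZMod.coe_unitOfCoprime] at h1
      rw [ZMod.natCast_eq_natCast_iff] at h1
      have h2 : a - 1 ≡ b - 1 [MOD n] := by
        apply Nat.ModEq.add_right_cancel' 1
        rwa [Nat.sub_add_cancel ha.1.1, Nat.sub_add_cancel hb.1.1]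
      have := Nat.ModEq.eq_of_lt_of_lt h2 (by omega) (by omega)
      omega
    · intro v _
      by_cases hv : (v : ZMod n).val = 0
      · have hc : Nat.Coprime n n := by
          have := ZMod.val_coe_unit_coprime v
          rw [hv] at this
          have : n = 1 := by simpa using this
          simp [this]
        refine ⟨n, Finset.mem_filter.2 ⟨Finset.mem_Icc.2 ⟨hn, le_rfl⟩, hc⟩, ?_⟩
        ext
        simp
        exact ((ZMod.val_eq_zero _).1 hv).symm
      · refine ⟨(v : ZMod n).val, ?_, ?_⟩
        · simp only [mem_filter, mem_Icc]
          exact ⟨⟨by omega, (ZMod.val_lt _).le⟩, ZMod.val_coe_unit_coprime v⟩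
        · ext; simp
    · intro a ha
      have ha' := Finset.mem_filter.1 ha
      have ha1 := (Finset.mem_Icc.1 ha'.1).1
      have : e ∣ a - 1 ↔ ZMod.unitOfCoprime a ha'.2 ∈ (ZMod.unitsMap he).ker := by
        rw [MonoidHom.mem_ker, Units.ext_iff, ZMod.unitsMap_val]
        simp only [ZMod.coe_unitOfCoprime, Units.val_one]
        rw [ZMod.cast_natCast he, ← Nat.modEq_iff_dvd' ha1, Nat.ModEq.comm,
          ← ZMod.natCast_eq_natCast_iff, Nat.cast_one]
      simp only [this, ZMod.coe_unitOfCoprime]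
  rw [step1]
  set K := (ZMod.unitsMap he).ker with hK
  let f : K →* ℂ := (Units.coeHom ℂ).comp (χ.toUnitHom.comp K.subtype)
  have step2 : (∑ v : (ZMod n)ˣ, if v ∈ K then χ v else 0) = ∑ g : K, f g := by
    rw [← Finset.sum_filter]
    have hfg : ∀ g : K, f g = (fun v : (ZMod n)ˣ => χ v) g := fun g => by simp [f]
    rw [Finset.sum_congr rfl fun g _ => hfg g]
    exact Finset.sum_subtype (univ.filter fun v => v ∈ K) (p := fun v => v ∈ K) (by simp)
      (fun v : (ZMod n)ˣ => χ v)
  have hcard : (Fintype.card K : ℂ) = (n.totient : ℂ) / e.totient := by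
    have h1 : Nat.card K * Nat.card (ZMod e)ˣ = Nat.card (ZMod n)ˣ := by
      have h2 := Subgroup.card_mul_index K
      rw [Subgroup.index_ker, MonoidHom.range_eq_top.2 (ZMod.unitsMap_surjective he)] at h2
      simpa using h2
    rw [Nat.card_eq_fintype_card, Nat.card_eq_fintype_card, Nat.card_eq_fintype_card,
      ZMod.card_units_eq_totient, ZMod.card_units_eq_totient] at h1
    rw [eq_div_iff (by simp [NeZero.ne e])]
    exact_mod_cast h1
  have hf : f = 1 ↔ χ.conductor ∣ e := by
    rw [← DirichletCharacter.mem_conductorSet_iff_conductor_dvd χ he,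
      DirichletCharacter.mem_conductorSet_iff, DirichletCharacter.factorsThrough_iff_ker_unitsMap he]
    constructor
    · intro h x hx
      have := DFunLike.congr_fun h ⟨x, hx⟩
      rw [MonoidHom.mem_ker, Units.ext_iff]
      simpa [f] using this
    · intro h
      ext ⟨x, hx⟩
      have := h hx
      rw [MonoidHom.mem_ker, Units.ext_iff] at this
      simpa [f] using this
  rw [step2, sum_hom_units]
  simp only [hf]
  split_ifs
  · exact hcard
  · simp

lemma ms_gcd (r s n : ℕ) (hn : 0 < n) (a : Fin s → ℕ) (b : Fin r → ℕ) :
   (Nat.gcd (Finset.univ.gcd fun i => a i - 1)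
            (Nat.gcd (Finset.univ.gcd fun j => b j) n) : ℂ) =
   ∑ e ∈ n.divisors, (e.totient : ℂ) * (∏ i, if e ∣ a i - 1 then 1 else 0) *
     (∏ j, if e ∣ b j then 1 else 0) := by
  set g := Nat.gcd (Finset.univ.gcd fun i => a i - 1) (Nat.gcd (Finset.univ.gcd fun j => b j) n)
    with hg
  have hgn : g ∣ n := (Nat.gcd_dvd_right _ _).trans (Nat.gcd_dvd_right _ _)
  have h1 : (g : ℂ) = ∑ e ∈ g.divisors, (e.totient : ℂ) := by
    exact_mod_cast (Nat.sum_totient g).symm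
  rw [h1]
  have h2 : g.divisors = n.divisors.filter (fun e => e ∣ g) := by
    ext e
    have : g ≠ 0 := fun h => hn.ne' (Nat.eq_zero_of_zero_dvd (h ▸ hgn))
    simp only [Nat.mem_divisors, mem_filter]
    exact ⟨fun h => ⟨⟨h.1.trans hgn, hn.ne'⟩, h.1⟩, fun h => ⟨h.2, this⟩⟩
  rw [h2, Finset.sum_filter]
  refine Finset.sum_congr rfl fun e he => ?_
  rw [Finset.prod_ite_zero, Finset.prod_ite_zero]
  have : e ∣ g ↔ (∀ i ∈ (univ : Finset (Fin s)), e ∣ a i - 1) ∧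
      (∀ j ∈ (univ : Finset (Fin r)), e ∣ b j) := by
    rw [hg, Nat.dvd_gcd_iff, Nat.dvd_gcd_iff, Finset.dvd_gcd_iff, Finset.dvd_gcd_iff]
    simp [Nat.dvd_of_mem_divisors he]
  simp only [this]
  split_ifs <;> simp_all

lemma ms_count (n e : ℕ) (he : e ∣ n) (hn : 0 < n) :
    (∑ b ∈ Finset.Icc 1 n, (if e ∣ b then 1 else 0 : ℂ)) = (n : ℂ) / e := by
  have he0 : (e : ℂ) ≠ 0 := by
    rintro h
    have : e = 0 := by exact_mod_cast h
    subst this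
    exact hn.ne' (Nat.eq_zero_of_zero_dvd he)
  rw [Finset.sum_boole, ← Nat.cast_div he he0, ← Nat.Ioc_filter_dvd_card_eq_div]
  rfl

lemma ms_expand (r s n : ℕ) (hn : 0 < n)
    (χ : Fin s → DirichletCharacter ℂ n) :
    ∑ a ∈ Fintype.piFinset (fun _ : Fin s => (Finset.Icc 1 n).filter fun x => Nat.Coprime x n),
      ∑ b ∈ Fintype.piFinset (fun _ : Fin r => Finset.Icc 1 n),
        (Nat.gcd (Finset.univ.gcd fun i => a i - 1)
            (Nat.gcd (Finset.univ.gcd fun j => b j) n) : ℂ) * ∏ i, χ i (a i)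
    = ∑ e ∈ n.divisors, (e.totient : ℂ) *
      (∏ i, if (χ i).conductor ∣ e then (n.totient : ℂ) / e.totient else 0) *
      ((n : ℂ) / e) ^ r := by
  have key : ∀ e ∈ n.divisors, (e.totient : ℂ) *
      (∏ i, if (χ i).conductor ∣ e then (n.totient : ℂ) / e.totient else 0) *
      ((n : ℂ) / e) ^ r = ∑ a ∈ Fintype.piFinset
        (fun _ : Fin s => (Finset.Icc 1 n).filter fun x => Nat.Coprime x n),
      ∑ b ∈ Fintype.piFinset (fun _ : Fin r => Finset.Icc 1 n),
      (e.totient : ℂ) * (∏ i, if e ∣ a i - 1 then χ i (a i) else 0) *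
     (∏ j, if e ∣ b j then 1 else 0) := by
    intro e he
    have he' := Nat.dvd_of_mem_divisors he
    simp_rw [← Finset.mul_sum, ← Finset.sum_mul, ← Finset.mul_sum]
    congr 1
    · rw [← Finset.prod_univ_sum (fun _ : Fin s => (Finset.Icc 1 n).filter fun x => Nat.Coprime x n)
        (fun i x => if e ∣ x - 1 then χ i (x : ZMod n) else 0)]
      congr 1
      exact Finset.prod_congr rfl fun i _ => (ms_charsum n hn (χ i) e he').symm
    · rw [← Finset.prod_univ_sum (fun _ : Fin r => Finset.Icc 1 n)
        (fun i x => if e ∣ x then (1 : ℂ) else 0)]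
      simp only [ms_count n e he' hn, Finset.prod_const, Finset.card_univ, Fintype.card_fin]
  rw [Finset.sum_congr rfl key, Finset.sum_comm (s := n.divisors)]
  refine Finset.sum_congr rfl fun a _ => ?_
  rw [Finset.sum_comm (s := n.divisors)]
  refine Finset.sum_congr rfl fun b _ => ?_
  rw [ms_gcd r s n hn a b, Finset.sum_mul]
  refine Finset.sum_congr rfl fun e _ => ?_
  have : (∏ i, if e ∣ a i - 1 then χ i (a i) else 0)
     = (∏ i, if e ∣ a i - 1 then (1 : ℂ) else 0) * ∏ i, χ i (a i) := by
    rw [← Finset.prod_mul_distrib]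
    exact Finset.prod_congr rfl fun i _ => by split_ifs <;> simp
  rw [this]
  ring

/-- Menon–Sury identity with several Dirichlet characters (general case). -/
theorem menon_sury_several_characters_general
    (r s n : ℕ) (hs : 0 < s) (hn : 0 < n)
    (χ : Fin s → DirichletCharacter ℂ n)
    (d : Fin s → ℕ) (hd : ∀ i, (χ i).conductor = d i)
    (D : ℕ) (hD : D = Finset.univ.lcm d)
    (n₀ : ℕ) (hn₀dvd : n₀ ∣ n) (hn₀pf : n₀.primeFactors = D.primeFactors)
    (hn₀max : ∀ m : ℕ, m ∣ n → m.primeFactors = D.primeFactors → m ≤ n₀) :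
    ∑ a ∈ Fintype.piFinset (fun _ : Fin s => (Finset.Icc 1 n).filter fun x => Nat.Coprime x n),
      ∑ b ∈ Fintype.piFinset (fun _ : Fin r => Finset.Icc 1 n),
        (Nat.gcd (Finset.univ.gcd fun i => a i - 1)
            (Nat.gcd (Finset.univ.gcd fun j => b j) n) : ℂ) * ∏ i, χ i (a i)
    = (Nat.totient n : ℂ) * (∑ e ∈ (n₀ / D).divisors, (e : ℂ) ^ (s + r - 1)) *
      ∏ p ∈ (n / n₀).primeFactors,
        ((Nat.totient (p ^ (n / n₀).factorization p) : ℂ) ^ (s - 1) *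
            (p : ℂ) ^ ((n / n₀).factorization p * r) +
          (∑ e ∈ (p ^ (n / n₀).factorization p).divisors, (e : ℂ) ^ (s + r - 1)) -
          (p : ℂ) ^ ((n / n₀).factorization p * (s + r - 1))) := by
  rw [ms_expand r s n hn χ]
  have hDn : D ∣ n := by
    rw [hD]
    exact Finset.lcm_dvd fun i _ => hd i ▸ (χ i).conductor_dvd_level
  obtain ⟨u, rfl⟩ : ∃ u, s = u + 1 := ⟨s - 1, by omega⟩
  have e1 : u + 1 + r - 1 = u + r := by omega
  simp only [e1, Nat.add_sub_cancel]
  obtain ⟨m, rfl⟩ := hn₀dvd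
  have h0 : n₀ ≠ 0 := left_ne_zero_of_mul hn.ne'
  have hm : m ≠ 0 := right_ne_zero_of_mul hn.ne'
  have hD0 : D ≠ 0 := fun h => hn.ne' (Nat.eq_zero_of_zero_dvd (h ▸ hDn))
  rw [Nat.mul_div_cancel_left m (Nat.pos_of_ne_zero h0), ← msG_eq_prod u r m hm]
  have hco : n₀.Coprime m := by
    refine Nat.coprime_of_dvd fun p hp h1 h2 => ?_
    have := hn₀max (n₀ * p) (mul_dvd_mul_left n₀ h2) (by
      rw [← hn₀pf, Nat.primeFactors_mul h0 hp.ne_zero, hp.primeFactors]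
      exact Finset.union_eq_left.2 (by simp [hp, h1, h0]))
    have := hp.two_le
    have := Nat.pos_of_ne_zero h0
    nlinarith
  have hDm : D.Coprime m := by
    rw [← Nat.disjoint_primeFactors hD0 hm, ← hn₀pf]
    exact hco.disjoint_primeFactors
  have hDn0 : D ∣ n₀ := hDm.dvd_of_dvd_mul_right hDn
  rw [mul_assoc, ← ms_divsum u r n₀ m D h0 hco hDn0 hn₀pf, Finset.sum_filter, Finset.mul_sum]
  refine Finset.sum_congr rfl fun e he => ?_
  have he0 : e ≠ 0 := (Nat.pos_of_mem_divisors he).ne'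
  have het : (e.totient : ℂ) ≠ 0 := by simp [he0]
  rw [Finset.prod_ite_zero]
  have : D ∣ e ↔ ∀ i ∈ (univ : Finset (Fin (u + 1))), (χ i).conductor ∣ e := by
    rw [hD, Finset.lcm_dvd_iff]; simp [hd]
  simp only [this]
  split_ifs
  · simp only [Finset.prod_const, Finset.card_univ, Fintype.card_fin, pow_succ]
    field_simp
  · simp
end

section
/- Let r ≥ 0, s > 0 and n > 0 be integers. Let χ₁, …, χ_s be Dirichlet characters modulo n with conductors d₁, …, d_s, and let d = lcm(d₁, …, d_s). If n and d have exactly the same prime factors, then ∑ gcd(a₁−1, …, a_s−1, b₁, …, b_r, n)·χ₁(a₁)⋯χ_s(a_s), where a₁, …, a_s range over integers in [1,n] coprime to n and b₁, …, b_r range over integers in [1,n], equals φ(n)·σ_{s+r−1}(n/d). -/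
open Finset

lemma aux_ker_card {n e : ℕ} [NeZero n] (he : e ∣ n) :
    (Nat.card (ZMod.unitsMap he).ker : ℂ) = (Nat.totient n : ℂ) / (Nat.totient e : ℂ) := by
  have hn : 0 < n := Nat.pos_of_ne_zero (NeZero.ne n)
  have he0 : 0 < e := Nat.pos_of_dvd_of_pos he hn
  haveI : NeZero e := ⟨he0.ne'⟩
  have h1 := Subgroup.card_mul_index (ZMod.unitsMap he).ker
  rw [Subgroup.index_ker, MonoidHom.range_eq_top.mpr (ZMod.unitsMap_surjective he)] at h1
  rw [Subgroup.card_top, Nat.card_eq_fintype_card (α := (ZMod e)ˣ),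
    Nat.card_eq_fintype_card (α := (ZMod n)ˣ), ZMod.card_units_eq_totient,
    ZMod.card_units_eq_totient] at h1
  have h2 : (Nat.totient e : ℂ) ≠ 0 := by
    exact_mod_cast (Nat.totient_pos.mpr he0).ne'
  rw [eq_div_iff h2, ← h1]
  push_cast
  rfl

lemma aux_units_sum {n e : ℕ} [NeZero n] (he : e ∣ n) (χ : DirichletCharacter ℂ n) :
    (∑ u : (ZMod n)ˣ, if ZMod.unitsMap he u = 1 then χ u else 0) =
      if χ.conductor ∣ e then (Nat.totient n : ℂ) / (Nat.totient e : ℂ) else 0 := by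
  classical
  let f : (ZMod.unitsMap he).ker →* ℂ :=
    ((Units.coeHom ℂ).comp χ.toUnitHom).comp (ZMod.unitsMap he).ker.subtype
  have hf : ∀ x, f x = χ ((x : (ZMod n)ˣ) : ZMod n) := by
    intro x
    simp [f, MulChar.coe_toUnitHom]
  have h1 : (∑ u : (ZMod n)ˣ, if ZMod.unitsMap he u = 1 then χ u else 0) =
      ∑ x : (ZMod.unitsMap he).ker, f x := by
    rw [← Finset.sum_filter]
    simp only [hf]
    refine Finset.sum_subtype (p := fun u => u ∈ (ZMod.unitsMap he).ker) _ ?_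
      (fun u : (ZMod n)ˣ => χ (u : ZMod n))
    intro x
    simp [MonoidHom.mem_ker]
  rw [h1, sum_hom_units f, ← aux_ker_card he, Nat.card_eq_fintype_card]
  have h2 : f = 1 ↔ χ.conductor ∣ e := by
    rw [← χ.mem_conductorSet_iff_conductor_dvd he, χ.mem_conductorSet_iff,
      DirichletCharacter.factorsThrough_iff_ker_unitsMap he]
    constructor
    · intro h x hx
      have := DFunLike.congr_fun h ⟨x, hx⟩
      rw [hf] at this
      rw [MonoidHom.mem_ker]
      ext
      simpa [MulChar.coe_toUnitHom] using this
    · intro h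
      ext x
      have := h x.2
      rw [MonoidHom.mem_ker] at this
      have h3 := congrArg Units.val this
      rw [MulChar.coe_toUnitHom] at h3
      simpa [hf] using h3
  simp only [h2]
  split_ifs <;> simp

lemma aux_char_sum {n e : ℕ} [NeZero n] (he : e ∣ n) (χ : DirichletCharacter ℂ n) :
    (∑ a ∈ (Finset.Icc 1 n).filter fun x => Nat.Coprime x n, if e ∣ a - 1 then χ a else 0) =
      if χ.conductor ∣ e then (Nat.totient n : ℂ) / (Nat.totient e : ℂ) else 0 := by
  rw [← aux_units_sum he χ]
  have hn : 0 < n := Nat.pos_of_ne_zero (NeZero.ne n)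
  refine Finset.sum_bij (fun a ha => ZMod.unitOfCoprime a (by simpa using (Finset.mem_filter.mp ha).2))
    ?_ ?_ ?_ ?_
  · intros; simp
  · intro a ha b hb hab
    simp only [Finset.mem_filter, Finset.mem_Icc] at ha hb
    have := congrArg Units.val hab
    simp only [ZMod.coe_unitOfCoprime] at this
    rw [ZMod.natCast_eq_natCast_iff] at this
    rcases eq_or_lt_of_le ha.1.2 with h | h <;> rcases eq_or_lt_of_le hb.1.2 with h' | h'
    · omega
    · subst h
      have h3 : b ≡ 0 [MOD a] := this.symm.trans (by simp [Nat.ModEq])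
      have := Nat.le_of_dvd (by omega) ((Nat.modEq_zero_iff_dvd).mp h3)
      omega
    · subst h'
      have h3 : a ≡ 0 [MOD b] := this.trans (by simp [Nat.ModEq])
      have := Nat.le_of_dvd (by omega) ((Nat.modEq_zero_iff_dvd).mp h3)
      omega
    · exact Nat.ModEq.eq_of_lt_of_lt this h h'
  · intro u _
    by_cases h1 : n = 1
    · subst h1
      exact ⟨1, by simp, Subsingleton.elim _ _⟩
    · refine ⟨(u : ZMod n).val, ?_, ?_⟩
      · have hc := ZMod.val_coe_unit_coprime u
        simp only [Finset.mem_filter, Finset.mem_Icc]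
        refine ⟨⟨?_, (ZMod.val_lt _).le⟩, hc⟩
        by_contra h
        have h0 : (u : ZMod n).val = 0 := by omega
        rw [h0] at hc
        simp at hc
        exact h1 hc
      · ext
        simp
  · intro a ha
    simp only [Finset.mem_filter, Finset.mem_Icc] at ha
    have : e ∣ a - 1 ↔ ZMod.unitsMap he (ZMod.unitOfCoprime a ha.2) = 1 := by
      rw [← Units.val_inj, ZMod.unitsMap_val]
      simp only [ZMod.coe_unitOfCoprime, Units.val_one, ZMod.cast_natCast he]
      rw [← Nat.cast_one (R := ZMod e), ZMod.natCast_eq_natCast_iff, Nat.ModEq.comm, Nat.modEq_iff_dvd' ha.1.1]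
    simp only [this, ZMod.coe_unitOfCoprime]

lemma aux_b_sum {n e : ℕ} (he : e ∣ n) :
    (∑ b ∈ Finset.Icc 1 n, if e ∣ b then (1 : ℂ) else 0) = ((n / e : ℕ) : ℂ) := by
  rw [Finset.sum_boole, ← Nat.Ioc_filter_dvd_card_eq_div n e]
  rfl

lemma aux_totient {n D e : ℕ} (hn : 0 < n) (hpf : n.primeFactors = D.primeFactors)
    (h1 : D ∣ e) (h2 : e ∣ n) : Nat.totient e * (n / e) = Nat.totient n := by
  have he0 : 0 < e := Nat.pos_of_dvd_of_pos h2 hn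
  have hp : e.primeFactors = n.primeFactors := by
    apply Finset.Subset.antisymm
    · exact Nat.primeFactors_mono h2 hn.ne'
    · rw [hpf]; exact Nat.primeFactors_mono h1 he0.ne'
  obtain ⟨k, rfl⟩ := h2
  have a1 := Nat.totient_mul_prod_primeFactors e
  have a2 := Nat.totient_mul_prod_primeFactors (e * k)
  rw [hp] at a1
  have hpos : 0 < ∏ p ∈ (e * k).primeFactors, p :=
    Finset.prod_pos fun p hp => (Nat.prime_of_mem_primeFactors hp).pos
  rw [Nat.mul_div_cancel_left _ he0]
  apply Nat.eq_of_mul_eq_mul_right hpos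
  rw [a2, mul_right_comm, a1]
  ring

lemma aux_gcd_sum {n m : ℕ} (hn : 0 < n) (hm : m ∣ n) :
    (m : ℂ) = ∑ e ∈ n.divisors, if e ∣ m then (Nat.totient e : ℂ) else 0 := by
  rw [← Finset.sum_filter]
  have : n.divisors.filter (fun e => e ∣ m) = m.divisors := by
    ext e
    simp only [Finset.mem_filter, Nat.mem_divisors]
    constructor
    · rintro ⟨_, h⟩
      exact ⟨h, (Nat.pos_of_dvd_of_pos hm hn).ne'⟩
    · rintro ⟨h, _⟩
      exact ⟨⟨h.trans hm, hn.ne'⟩, h⟩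
  rw [this]
  exact_mod_cast (Nat.sum_totient m).symm

/-- Menon–Sury identity with several Dirichlet characters, when the
lcm of the conductors has exactly the same prime factors as the modulus. -/
theorem menon_sury_several_characters_same_prime_factors
    (r s n : ℕ) (hs : 0 < s) (hn : 0 < n)
    (χ : Fin s → DirichletCharacter ℂ n)
    (d : Fin s → ℕ) (hd : ∀ i, (χ i).conductor = d i)
    (D : ℕ) (hD : D = Finset.univ.lcm d)
    (hpf : n.primeFactors = D.primeFactors) :
    ∑ a ∈ Fintype.piFinset (fun _ : Fin s => (Finset.Icc 1 n).filter fun x => Nat.Coprime x n),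
      ∑ b ∈ Fintype.piFinset (fun _ : Fin r => Finset.Icc 1 n),
        (Nat.gcd (Finset.univ.gcd fun i => a i - 1)
            (Nat.gcd (Finset.univ.gcd fun j => b j) n) : ℂ) * ∏ i, χ i (a i)
    = (Nat.totient n : ℂ) * ∑ e ∈ (n / D).divisors, (e : ℂ) ^ (s + r - 1) := by
  haveI : NeZero n := ⟨hn.ne'⟩
  have hDn : D ∣ n := by
    rw [hD]
    exact Finset.lcm_dvd fun i _ => hd i ▸ (χ i).conductor_dvd_level
  have hD0 : 0 < D := Nat.pos_of_dvd_of_pos hDn hn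
  have key : ∀ (a : Fin s → ℕ) (b : Fin r → ℕ),
      (Nat.gcd (Finset.univ.gcd fun i => a i - 1)
            (Nat.gcd (Finset.univ.gcd fun j => b j) n) : ℂ) * ∏ i, χ i (a i) =
      ∑ e ∈ n.divisors, (Nat.totient e : ℂ) *
        ((∏ i, if e ∣ a i - 1 then χ i (a i) else 0) * ∏ j, if e ∣ b j then (1 : ℂ) else 0) := by
    intro a b
    rw [aux_gcd_sum hn ((Nat.gcd_dvd_right _ _).trans (Nat.gcd_dvd_right _ _)), Finset.sum_mul]
    refine Finset.sum_congr rfl fun e he => ?_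
    have hen := (Nat.mem_divisors.mp he).1
    simp only [Nat.dvd_gcd_iff, Finset.dvd_gcd_iff, Finset.mem_univ, true_implies, hen, and_true]
    by_cases h1 : ∀ i, e ∣ a i - 1
    · by_cases h2 : ∀ j, e ∣ b j
      · simp [h1, h2]
      · rw [if_neg (fun h => h2 h.2)]
        push Not at h2
        obtain ⟨j, hj⟩ := h2
        rw [Finset.prod_eq_zero (i := j) (s := Finset.univ)
          (f := fun j => if e ∣ b j then (1 : ℂ) else 0) (Finset.mem_univ _) (by simp [hj])]
        simp
    · rw [if_neg (fun h => h1 h.1)]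
      push Not at h1
      obtain ⟨j, hj⟩ := h1
      rw [Finset.prod_eq_zero (i := j) (s := Finset.univ)
        (f := fun i => if e ∣ a i - 1 then χ i (a i) else 0) (Finset.mem_univ _) (by simp [hj])]
      simp
  simp only [key]
  have swap : ∀ a : Fin s → ℕ,
      (∑ b ∈ Fintype.piFinset (fun _ : Fin r => Finset.Icc 1 n), ∑ e ∈ n.divisors,
        (Nat.totient e : ℂ) *
        ((∏ i, if e ∣ a i - 1 then χ i (a i) else 0) * ∏ j, if e ∣ b j then (1 : ℂ) else 0)) =
      ∑ e ∈ n.divisors, (Nat.totient e : ℂ) *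
        ((∏ i, if e ∣ a i - 1 then χ i (a i) else 0) * ((n / e : ℕ) : ℂ) ^ r) := by
    intro a
    rw [Finset.sum_comm]
    refine Finset.sum_congr rfl fun e he => ?_
    have hen := (Nat.mem_divisors.mp he).1
    rw [← Finset.mul_sum, ← Finset.mul_sum,
      ← Finset.prod_univ_sum (fun _ : Fin r => Finset.Icc 1 n)
        (fun _ b => if e ∣ b then (1 : ℂ) else 0)]
    simp [aux_b_sum hen]
  simp only [swap]
  rw [Finset.sum_comm]
  have step : ∀ e ∈ n.divisors,
      (∑ a ∈ Fintype.piFinset (fun _ : Fin s => (Finset.Icc 1 n).filter fun x => Nat.Coprime x n),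
        (Nat.totient e : ℂ) *
        ((∏ i, if e ∣ a i - 1 then χ i (a i) else 0) * ((n / e : ℕ) : ℂ) ^ r)) =
      if D ∣ e then (Nat.totient n : ℂ) * ((n / e : ℕ) : ℂ) ^ (s + r - 1) else 0 := by
    intro e he
    have hen := (Nat.mem_divisors.mp he).1
    have he0 : 0 < e := Nat.pos_of_dvd_of_pos hen hn
    rw [← Finset.mul_sum, ← Finset.sum_mul,
      ← Finset.prod_univ_sum
        (fun _ : Fin s => (Finset.Icc 1 n).filter fun x => Nat.Coprime x n)
        (fun i a => if e ∣ a - 1 then χ i a else 0)]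
    simp only [aux_char_sum hen, hd]
    split_ifs with h
    · have hde : ∀ i, d i ∣ e := fun i =>
        (hD ▸ Finset.dvd_lcm (Finset.mem_univ i) : d i ∣ D).trans h
      have ht := aux_totient hn hpf h hen
      have h2 : (Nat.totient e : ℂ) ≠ 0 := by
        exact_mod_cast (Nat.totient_pos.mpr he0).ne'
      have h3 : (Nat.totient n : ℂ) / (Nat.totient e : ℂ) = ((n / e : ℕ) : ℂ) := by
        rw [div_eq_iff h2, ← ht]
        push_cast
        ring
      simp only [hde, if_true, h3, Finset.prod_const, Finset.card_univ, Fintype.card_fin]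
      obtain ⟨t, rfl⟩ : ∃ t, s = t + 1 := ⟨s - 1, by omega⟩
      have h4 : t + 1 + r - 1 = t + r := by omega
      rw [h4, ← ht]
      push_cast
      ring
    · have : ∃ i, ¬ d i ∣ e := by
        by_contra hh
        push Not at hh
        exact h (hD ▸ Finset.lcm_dvd fun i _ => hh i)
      obtain ⟨i, hi⟩ := this
      rw [Finset.prod_eq_zero (i := i) (Finset.mem_univ _) (by simp [hi])]
      simp
  rw [Finset.sum_congr rfl step, ← Finset.sum_filter, Finset.mul_sum]
  refine Finset.sum_nbij' (fun e => n / e) (fun f => n / f) ?_ ?_ ?_ ?_ ?_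
  · intro e he
    simp only [Finset.mem_filter, Nat.mem_divisors] at he ⊢
    obtain ⟨⟨⟨k, rfl⟩, _⟩, ⟨l, rfl⟩⟩ := he
    have hl : 0 < D * l := Nat.pos_of_mul_pos_right hn
    rw [Nat.mul_div_cancel_left _ hl, mul_assoc, Nat.mul_div_cancel_left _ hD0]
    refine ⟨Dvd.intro_left l rfl, ?_⟩
    rintro h
    rw [mul_assoc, h] at hn
    simp at hn
  · intro f hf
    simp only [Finset.mem_filter, Nat.mem_divisors] at hf ⊢
    obtain ⟨m, rfl⟩ := hDn
    rw [Nat.mul_div_cancel_left _ hD0] at hf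
    obtain ⟨⟨k, rfl⟩, hk⟩ := hf
    have hf0 : 0 < f := Nat.pos_of_ne_zero (by rintro rfl; simp at hk)
    have : D * (f * k) / f = D * k := by
      rw [mul_left_comm, Nat.mul_div_cancel_left _ hf0]
    rw [this]
    exact ⟨⟨⟨f, by ring⟩, hn.ne'⟩, ⟨k, rfl⟩⟩
  · intro e he
    simp only [Finset.mem_filter, Nat.mem_divisors] at he
    exact Nat.div_div_self he.1.1 hn.ne'
  · intro f hf
    simp only [Nat.mem_divisors] at hf
    exact Nat.div_div_self (hf.1.trans (Nat.div_dvd_of_dvd hDn)) hn.ne'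
  · intro e he
    rfl
end

section
/- Let r ≥ 0 and s > 0 be integers, let n = p^m be a prime power, and let χ₁, …, χ_s be Dirichlet characters modulo n with conductors d_i = p^{t_i}. Set u = max(t₁, …, t_s) and assume u > 0. Then ∑ gcd(a₁−1, …, a_s−1, b₁, …, b_r, p^m)·χ₁(a₁)⋯χ_s(a_s), where a₁, …, a_s range over integers in [1,p^m] coprime to p, and b₁, …, b_r range over integers in [1,p^m], equals φ(p^m)·σ_{s+r−1}(p^{m−u}). -/
open Finset

lemma ms_sum_Icc_cast (n : ℕ) [NeZero n] (f : ZMod n → ℂ) :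
    ∑ a ∈ Finset.Icc 1 n, f (a : ZMod n) = ∑ x : ZMod n, f x := by
  have hn : 0 < n := Nat.pos_of_ne_zero (NeZero.ne n)
  refine Finset.sum_nbij (fun a : ℕ => (a : ZMod n)) (by simp) ?_ ?_ (fun _ _ => rfl)
  · intro a ha b hb hab
    simp only [Finset.coe_Icc, Set.mem_Icc] at ha hb
    have h := (ZMod.natCast_eq_natCast_iff a b n).1 hab
    rcases le_total a b with hl | hl
    · have h2 := (Nat.modEq_iff_dvd' hl).1 h
      have := Nat.eq_zero_of_dvd_of_lt h2 (by omega)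
      omega
    · have h2 := (Nat.modEq_iff_dvd' hl).1 h.symm
      have := Nat.eq_zero_of_dvd_of_lt h2 (by omega)
      omega
  · intro x _
    by_cases hx : x = 0
    · exact ⟨n, by simp; omega, by simp [hx]⟩
    · refine ⟨x.val, ?_, by simp⟩
      have h1 := ZMod.val_lt x
      have h2 : x.val ≠ 0 := by simpa using hx
      simp only [Finset.coe_Icc, Set.mem_Icc]
      omega

lemma ms_dvd_iff {p k a : ℕ} (ha : 1 ≤ a) : p ^ k ∣ a - 1 ↔ (a : ZMod (p ^ k)) = 1 := by
  rw [← Nat.modEq_iff_dvd' ha, ← ZMod.natCast_eq_natCast_iff, Nat.cast_one]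
  exact eq_comm

lemma ms_vanish {p m k t : ℕ} (hp : p.Prime) (hm : 0 < m)
    (χ : DirichletCharacter ℂ (p ^ m)) (ht : χ.conductor = p ^ t) (hkm : k ≤ m) (hkt : k < t) :
    ∑ a ∈ (Finset.Icc 1 (p ^ m)).filter (fun x => Nat.Coprime x p),
      (if p ^ k ∣ a - 1 then χ (a : ZMod (p ^ m)) else 0) = 0 := by
  haveI : NeZero (p ^ m) := ⟨pow_ne_zero _ hp.ne_zero⟩
  have hd : p ^ k ∣ p ^ m := pow_dvd_pow p hkm
  have hnf : ¬ χ.FactorsThrough (p ^ k) := by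
    intro h
    have h1 : χ.conductor ≤ p ^ k := Nat.sInf_le h
    rw [ht] at h1
    exact absurd h1 (not_le.2 (Nat.pow_lt_pow_right hp.one_lt hkt))
  rw [DirichletCharacter.factorsThrough_iff_ker_unitsMap hd, SetLike.not_le_iff_exists] at hnf
  obtain ⟨y, hy1, hy2⟩ := hnf
  have hy1' : ZMod.castHom hd (ZMod (p ^ k)) (y : ZMod (p ^ m)) = 1 := by
    have := congrArg Units.val (MonoidHom.mem_ker.1 hy1)
    simpa [ZMod.unitsMap_val] using this
  have hy2' : χ (y : ZMod (p ^ m)) ≠ 1 := by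
    intro h
    apply hy2
    rw [MonoidHom.mem_ker, Units.ext_iff, MulChar.coe_toUnitHom, h, Units.val_one]
  set F : ZMod (p ^ m) → ℂ := fun x => if ZMod.castHom hd (ZMod (p ^ k)) x = 1 then χ x else 0
    with hF
  have hsum : ∑ a ∈ (Finset.Icc 1 (p ^ m)).filter (fun x => Nat.Coprime x p),
      (if p ^ k ∣ a - 1 then χ (a : ZMod (p ^ m)) else 0) = ∑ x, F x := by
    rw [← ms_sum_Icc_cast, Finset.sum_filter]
    refine Finset.sum_congr rfl fun a ha => ?_
    simp only [hF, map_natCast, ms_dvd_iff (Finset.mem_Icc.1 ha).1]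
    by_cases hc : Nat.Coprime a p
    · simp [hc]
    · have : χ (a : ZMod (p ^ m)) = 0 := by
        apply MulChar.map_nonunit
        rw [ZMod.isUnit_iff_coprime]
        intro h
        exact hc ((Nat.coprime_pow_right_iff hm a p).1 h)
      simp [this]
  rw [hsum]
  have h2 : ∑ x, F x = χ y * ∑ x, F x := by
    rw [Finset.mul_sum]
    refine (Fintype.sum_equiv (Units.mulLeft y) _ _ fun x => ?_).symm
    simp only [hF, Units.mulLeft_apply, map_mul, hy1', one_mul, mul_ite, mul_zero]
  have h3 : (1 - χ (y : ZMod (p ^ m))) * ∑ x, F x = 0 := by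
    rw [sub_mul, one_mul, ← h2, sub_self]
  rcases mul_eq_zero.1 h3 with h | h
  · exact absurd (sub_eq_zero.1 h).symm hy2'
  · exact h

lemma ms_card {p m k : ℕ} (hp : p.Prime) (hkm : k ≤ m) :
    ((Finset.Icc 1 (p ^ m)).filter (fun a => p ^ k ∣ a - 1)).card = p ^ (m - k) := by
  have hpk : 0 < p ^ k := pow_pos hp.pos k
  have hmul : p ^ m = p ^ k * p ^ (m - k) := by rw [← pow_add]; congr 1; omega
  rw [← Finset.card_range (p ^ (m - k))]
  symm
  refine Finset.card_nbij (fun j => p ^ k * j + 1) ?_ ?_ ?_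
  · intro j hj
    simp only [Finset.coe_range, Set.mem_Iio] at hj
    simp only [Finset.coe_filter, Finset.mem_Icc, Set.mem_ofPred_eq]
    refine ⟨⟨by omega, ?_⟩, by simp⟩
    rw [hmul]
    exact Nat.succ_le_of_lt (Nat.mul_lt_mul_of_pos_left (by simpa using hj) hpk)
  · intro i _ j _ h
    simpa [hp.ne_zero] using h
  · intro a ha
    simp only [Finset.coe_filter, Finset.mem_Icc, Set.mem_ofPred_eq] at ha
    obtain ⟨⟨h1, h2⟩, j, hj⟩ := ha
    refine ⟨j, ?_, by simp only; omega⟩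
    simp only [Finset.coe_range, Set.mem_Iio]
    have : p ^ k * j < p ^ k * p ^ (m - k) := by omega
    exact Nat.lt_of_mul_lt_mul_left this

lemma ms_count_s2 {p m k t : ℕ} (hp : p.Prime) (hk : 0 < k)
    (χ : DirichletCharacter ℂ (p ^ m)) (ht : χ.conductor = p ^ t) (hkm : k ≤ m) (hkt : t ≤ k) :
    ∑ a ∈ (Finset.Icc 1 (p ^ m)).filter (fun x => Nat.Coprime x p),
      (if p ^ k ∣ a - 1 then χ (a : ZMod (p ^ m)) else 0) = ((p : ℂ) ^ (m - k)) := by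
  haveI : NeZero (p ^ m) := ⟨pow_ne_zero _ hp.ne_zero⟩
  have hd : p ^ k ∣ p ^ m := pow_dvd_pow p hkm
  have hf : χ.FactorsThrough (p ^ k) :=
    (ht ▸ χ.factorsThrough_conductor).mono _ (pow_dvd_pow p hkt) hd
  rw [DirichletCharacter.factorsThrough_iff_ker_unitsMap hd] at hf
  rw [Finset.sum_filter]
  have : ∀ a ∈ Finset.Icc 1 (p ^ m), (if Nat.Coprime a p then
      (if p ^ k ∣ a - 1 then χ (a : ZMod (p ^ m)) else 0) else 0)
      = if p ^ k ∣ a - 1 then (1 : ℂ) else 0 := by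
    intro a ha
    have ha1 := (Finset.mem_Icc.1 ha).1
    by_cases h : p ^ k ∣ a - 1
    · have hc : Nat.Coprime a p := by
        refine Nat.Coprime.symm ((Nat.Prime.coprime_iff_not_dvd hp).2 fun h2 => ?_)
        have h3 : p ∣ a - 1 := (dvd_pow_self p hk.ne').trans h
        have h4 := (Nat.dvd_sub h2 h3)
        have : a - (a - 1) = 1 := by omega
        rw [this] at h4
        exact hp.one_lt.ne' (Nat.dvd_one.1 h4)
      have hcm : Nat.Coprime a (p ^ m) := Nat.Coprime.pow_right m hc
      have hker : ZMod.unitOfCoprime a hcm ∈ (ZMod.unitsMap hd).ker := by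
        rw [MonoidHom.mem_ker, Units.ext_iff, ZMod.unitsMap_val, ZMod.coe_unitOfCoprime,
          ZMod.cast_natCast hd, Units.val_one]
        exact (ms_dvd_iff ha1).1 h
      have := hf hker
      rw [MonoidHom.mem_ker, Units.ext_iff, MulChar.coe_toUnitHom, Units.val_one,
        ZMod.coe_unitOfCoprime] at this
      simp [hc, h, this]
    · simp [h]
  rw [Finset.sum_congr rfl this, Finset.sum_boole, ms_card hp hkm]
  push_cast
  rfl

lemma ms_cardb {p m k : ℕ} (hp : p.Prime) (hkm : k ≤ m) :
    ∑ b ∈ Finset.Icc 1 (p ^ m), (if p ^ k ∣ b then (1 : ℂ) else 0) = ((p : ℂ) ^ (m - k)) := by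
  have hpk : 0 < p ^ k := pow_pos hp.pos k
  rw [Finset.sum_boole]
  have h1 : Finset.Icc 1 (p ^ m) = Finset.Ioc 0 (p ^ m) := by ext; simp [Nat.succ_le_iff]
  rw [h1, Nat.Ioc_filter_dvd_card_eq_div, Nat.pow_div hkm hp.pos]
  push_cast
  rfl

lemma ms_gcd_s2 {p m g : ℕ} (hp : p.Prime) (hg : g ∣ p ^ m) :
    (g : ℂ) = ∑ k ∈ Finset.range (m + 1),
      if p ^ k ∣ g then ((p ^ k).totient : ℂ) else 0 := by
  have h0 : p ^ m ≠ 0 := pow_ne_zero _ hp.ne_zero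
  have h : g = ∑ k ∈ Finset.range (m + 1), if p ^ k ∣ g then (p ^ k).totient else 0 := by
    conv_lhs => rw [← Nat.sum_totient g]
    have hdiv : g.divisors = (p ^ m).divisors.filter (fun d => d ∣ g) := by
      ext d
      simp only [Nat.mem_divisors, Finset.mem_filter]
      exact ⟨fun ⟨a, b⟩ => ⟨⟨a.trans hg, h0⟩, a⟩, fun ⟨_, a⟩ => ⟨a, ne_zero_of_dvd_ne_zero h0 hg⟩⟩
    rw [hdiv, Finset.sum_filter, Nat.divisors_prime_pow hp, Finset.sum_map]
    rfl
  conv_lhs => rw [h]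
  push_cast
  rfl

/-- prime power case of the Menon–Sury identity with several
Dirichlet characters, when `u = max t_i > 0`. -/
theorem menon_sury_prime_power_u_pos
    (p m r s : ℕ) (hp : p.Prime) (hm : 0 < m) (hs : 0 < s)
    (χ : Fin s → DirichletCharacter ℂ (p ^ m))
    (t : Fin s → ℕ) (ht : ∀ i, (χ i).conductor = p ^ t i) (htm : ∀ i, t i ≤ m)
    (u : ℕ) (hu : u = Finset.univ.sup t) (hu0 : 0 < u) :
    ∑ a ∈ Fintype.piFinset
        (fun _ : Fin s => (Finset.Icc 1 (p ^ m)).filter fun x => Nat.Coprime x p),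
      ∑ b ∈ Fintype.piFinset (fun _ : Fin r => Finset.Icc 1 (p ^ m)),
        (Nat.gcd (Finset.univ.gcd fun i => a i - 1)
            (Nat.gcd (Finset.univ.gcd fun j => b j) (p ^ m)) : ℂ) * ∏ i, χ i (a i)
    = (Nat.totient (p ^ m) : ℂ) *
        ∑ e ∈ (p ^ (m - u)).divisors, (e : ℂ) ^ (s + r - 1) := by
  have hum : u ≤ m := hu ▸ Finset.sup_le fun i _ => htm i
  have key : ∀ (a : Fin s → ℕ) (b : Fin r → ℕ),
      (Nat.gcd (Finset.univ.gcd fun i => a i - 1)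
            (Nat.gcd (Finset.univ.gcd fun j => b j) (p ^ m)) : ℂ) * ∏ i, χ i (a i)
      = ∑ k ∈ Finset.range (m + 1), ((p ^ k).totient : ℂ) *
          ((∏ i, if p ^ k ∣ a i - 1 then χ i (a i) else 0) *
            ∏ j, if p ^ k ∣ b j then (1 : ℂ) else 0) := by
    intro a b
    rw [ms_gcd_s2 hp ((Nat.gcd_dvd_right _ _).trans (Nat.gcd_dvd_right _ _)), Finset.sum_mul]
    refine Finset.sum_congr rfl fun k hk => ?_
    have hkm : p ^ k ∣ p ^ m := pow_dvd_pow p (by simp at hk; omega)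
    have hiff : p ^ k ∣ Nat.gcd (Finset.univ.gcd fun i => a i - 1)
            (Nat.gcd (Finset.univ.gcd fun j => b j) (p ^ m)) ↔
          (∀ i, p ^ k ∣ a i - 1) ∧ ∀ j, p ^ k ∣ b j := by
      simp [Nat.dvd_gcd_iff, Finset.dvd_gcd_iff, hkm]
    simp only [hiff]
    by_cases h1 : ∀ i, p ^ k ∣ a i - 1
    · by_cases h2 : ∀ j, p ^ k ∣ b j
      · simp [h1, h2]
      · obtain ⟨j, hj⟩ := not_forall.1 h2
        have : ∏ j, (if p ^ k ∣ b j then (1 : ℂ) else 0) = 0 :=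
          Finset.prod_eq_zero (Finset.mem_univ j) (by simp [hj])
        rw [this, if_neg (fun h => h2 h.2)]
        simp
    · obtain ⟨j, hj⟩ := not_forall.1 h1
      have : ∏ i, (if p ^ k ∣ a i - 1 then χ i (a i) else 0) = 0 :=
        Finset.prod_eq_zero (Finset.mem_univ j) (by simp [hj])
      rw [this, if_neg (fun h => h1 h.1)]
      simp
  simp only [key]
  have swap : ∀ a : Fin s → ℕ, ∑ b ∈ Fintype.piFinset (fun _ : Fin r => Finset.Icc 1 (p ^ m)),
      ∑ k ∈ Finset.range (m + 1), ((p ^ k).totient : ℂ) *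
          ((∏ i, if p ^ k ∣ a i - 1 then χ i (a i) else 0) *
            ∏ j, if p ^ k ∣ b j then (1 : ℂ) else 0)
      = ∑ k ∈ Finset.range (m + 1), ((p ^ k).totient : ℂ) *
          (∏ i, if p ^ k ∣ a i - 1 then χ i (a i) else 0) * ((p : ℂ) ^ (m - k)) ^ r := by
    intro a
    rw [Finset.sum_comm]
    refine Finset.sum_congr rfl fun k hk => ?_
    rw [← Finset.mul_sum, ← Finset.mul_sum, ← mul_assoc]
    congr 1
    rw [← Finset.prod_univ_sum (fun _ : Fin r => Finset.Icc 1 (p ^ m))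
      (fun _ b => if p ^ k ∣ b then (1 : ℂ) else 0)]
    rw [ms_cardb hp (by simp at hk; omega)]
    simp
  simp only [swap]
  rw [Finset.sum_comm]
  have step : ∀ k ∈ Finset.range (m + 1), ∑ a ∈ Fintype.piFinset
        (fun _ : Fin s => (Finset.Icc 1 (p ^ m)).filter fun x => Nat.Coprime x p),
        ((p ^ k).totient : ℂ) *
          (∏ i, if p ^ k ∣ a i - 1 then χ i (a i) else 0) * ((p : ℂ) ^ (m - k)) ^ r
      = if u ≤ k then ((p ^ m).totient : ℂ) * ((p : ℂ) ^ (m - k)) ^ (s + r - 1) else 0 := by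
    intro k hk
    have hkm : k ≤ m := by simp at hk; omega
    rw [← Finset.sum_mul, ← Finset.mul_sum,
      ← Finset.prod_univ_sum
        (fun _ : Fin s => (Finset.Icc 1 (p ^ m)).filter fun x => Nat.Coprime x p)
        (fun i a => if p ^ k ∣ a - 1 then χ i (a : ZMod (p ^ m)) else 0)]
    by_cases huk : u ≤ k
    · rw [if_pos huk]
      have hk0 : 0 < k := lt_of_lt_of_le hu0 huk
      rw [Finset.prod_congr rfl fun i _ => ms_count_s2 hp hk0 (χ i) (ht i) hkm
        ((Finset.le_sup (Finset.mem_univ i)).trans (hu ▸ huk))]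
      have htot : ((p ^ m).totient : ℂ) = ((p ^ k).totient : ℂ) * (p : ℂ) ^ (m - k) := by
        rw [Nat.totient_prime_pow hp hm, Nat.totient_prime_pow hp hk0]
        have : m - 1 = (k - 1) + (m - k) := by omega
        rw [this, pow_add]
        push_cast
        ring
      rw [htot, Finset.prod_const, Finset.card_univ, Fintype.card_fin]
      obtain ⟨s', rfl⟩ : ∃ s', s = s' + 1 := ⟨s - 1, by omega⟩
      have : s' + 1 + r - 1 = s' + r := by omega
      rw [this]
      ring
    · rw [if_neg huk]
      have : ∃ i, k < t i := by
        by_contra hcon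
        push Not at hcon
        exact huk (hu ▸ Finset.sup_le fun i _ => hcon i)
      obtain ⟨i, hi⟩ := this
      rw [Finset.prod_eq_zero (Finset.mem_univ i) (ms_vanish hp hm (χ i) (ht i) hkm hi)]
      simp
  rw [Finset.sum_congr rfl step, ← Finset.sum_filter, ← Finset.mul_sum]
  congr 1
  rw [Nat.divisors_prime_pow hp, Finset.sum_map]
  refine Finset.sum_nbij' (fun k => m - k) (fun k => m - k) ?_ ?_ ?_ ?_ ?_
  · intro k hk; simp at hk ⊢; omega
  · intro k hk; simp at hk ⊢; omega
  · intro k hk; simp at hk ⊢; omega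
  · intro k hk; simp at hk ⊢; omega
  · intro k hk; simp
end

section
/- Let r ≥ 0 and s > 0 be integers and let n = p^m be a prime power. If χ₁, …, χ_s are all the trivial (principal) Dirichlet character modulo p^m, then ∑ gcd(a₁−1, …, a_s−1, b₁, …, b_r, p^m), where a₁, …, a_s range over integers in [1,p^m] coprime to p and b₁, …, b_r range over integers in [1,p^m], equals φ(p^m)·(φ(p^m)^{s−1}·p^{mr} + σ_{s+r−1}(p^m) − p^{m(s+r−1)}). -/
open Finset

lemma msp_gcd_expand (n g : ℕ) (hn : n ≠ 0) (hg : g ∣ n) :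
    (g : ℤ) = ∑ d ∈ n.divisors, if d ∣ g then (Nat.totient d : ℤ) else 0 := by
  rw [← Finset.sum_filter]
  have h : n.divisors.filter (fun d => d ∣ g) = g.divisors := by
    ext d
    simp only [Finset.mem_filter, Nat.mem_divisors]
    constructor
    · rintro ⟨-, h⟩
      exact ⟨h, fun h0 => hn (by subst h0; exact Nat.eq_zero_of_zero_dvd hg)⟩
    · rintro ⟨h, -⟩
      exact ⟨⟨h.trans hg, hn⟩, h⟩
  rw [h]
  exact_mod_cast (Nat.sum_totient g).symm

lemma msp_count_b (p m k : ℕ) (hp : p.Prime) (hk : k ≤ m) :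
    #((Finset.Icc 1 (p ^ m)).filter fun x => p ^ k ∣ x) = p ^ (m - k) := by
  have := Nat.Ioc_filter_dvd_card_eq_div (p ^ m) (p ^ k)
  rw [Nat.pow_div hk hp.pos] at this
  exact this

lemma msp_count_a (p m k : ℕ) (hp : p.Prime) (hk : k ≤ m) (hk0 : 0 < k) :
    #(((Finset.Icc 1 (p ^ m)).filter fun x => Nat.Coprime x p).filter fun x => p ^ k ∣ x - 1)
      = p ^ (m - k) := by
  have hpk : 0 < p ^ k := pow_pos hp.pos k
  have hmul : p ^ k * p ^ (m - k) = p ^ m := by rw [← pow_add]; congr 1; omega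
  have h : ((Finset.Icc 1 (p ^ m)).filter fun x => Nat.Coprime x p).filter
      (fun x => p ^ k ∣ x - 1) = (Finset.range (p ^ (m - k))).image (fun j => p ^ k * j + 1) := by
    ext x
    simp only [Finset.mem_filter, Finset.mem_Icc, Finset.mem_image, Finset.mem_range]
    constructor
    · rintro ⟨⟨⟨h1, h2⟩, -⟩, j, hj⟩
      refine ⟨j, ?_, by omega⟩
      rw [← hmul] at h2
      exact Nat.lt_of_mul_lt_mul_left (a := p ^ k) (by omega)
    · rintro ⟨j, hj, rfl⟩
      refine ⟨⟨⟨by omega, ?_⟩, ?_⟩, by simp⟩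
      · rw [← hmul]
        exact Nat.mul_lt_mul_of_pos_left hj hpk
      · obtain ⟨c, hc⟩ := dvd_pow_self p hk0.ne'
        rw [hc, mul_assoc]
        simp
  rw [h, Finset.card_image_of_injective, Finset.card_range]
  intro i j hij
  simpa [hpk.ne', hp.ne_zero] using hij

lemma msp_count_one (p m : ℕ) (hm : 0 < m) :
    #((Finset.Icc 1 (p ^ m)).filter fun x => Nat.Coprime x p) = Nat.totient (p ^ m) := by
  rw [← Nat.filter_coprime_Ico_eq_totient (p ^ m) 1]
  congr 1
  ext x
  simp only [Finset.mem_filter, Finset.mem_Icc, Finset.mem_Ico]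
  rw [Nat.coprime_pow_left_iff hm, Nat.coprime_comm]
  have : x ≤ p ^ m ↔ x < 1 + p ^ m := by omega
  rw [this]

lemma msp_sum_pi (s : ℕ) (A : Finset ℕ) (P : ℕ → Prop) [DecidablePred P] :
    ∑ a ∈ Fintype.piFinset (fun _ : Fin s => A), (if ∀ i, P (a i) then (1 : ℤ) else 0)
      = (#(A.filter P) : ℤ) ^ s := by
  have h : ∀ a : Fin s → ℕ, (if ∀ i, P (a i) then (1 : ℤ) else 0)
      = ∏ i, if P (a i) then (1 : ℤ) else 0 := by
    intro a
    rw [Finset.prod_ite_zero]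
    simp
  simp_rw [h]
  rw [← Finset.prod_univ_sum (fun _ : Fin s => A) (fun _ x => if P x then (1 : ℤ) else 0)]
  simp

/-- prime power case of the Menon–Sury identity when all the
characters are trivial (so the character values all equal 1 and drop out). -/
theorem menon_sury_prime_power_trivial_characters
    (p m r s : ℕ) (hp : p.Prime) (hm : 0 < m) (hs : 0 < s)
    (χ : Fin s → DirichletCharacter ℂ (p ^ m)) (hχ : ∀ i, χ i = 1) :
    ∑ a ∈ Fintype.piFinset
        (fun _ : Fin s => (Finset.Icc 1 (p ^ m)).filter fun x => Nat.Coprime x p),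
      ∑ b ∈ Fintype.piFinset (fun _ : Fin r => Finset.Icc 1 (p ^ m)),
        (Nat.gcd (Finset.univ.gcd fun i => a i - 1)
            (Nat.gcd (Finset.univ.gcd fun j => b j) (p ^ m)) : ℤ)
    = (Nat.totient (p ^ m) : ℤ) *
        ((Nat.totient (p ^ m) : ℤ) ^ (s - 1) * (p : ℤ) ^ (m * r) +
          (∑ e ∈ (p ^ m).divisors, (e : ℤ) ^ (s + r - 1)) -
          (p : ℤ) ^ (m * (s + r - 1))) := by
  have hn : p ^ m ≠ 0 := pow_ne_zero _ hp.ne_zero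
  have key : ∀ (a : Fin s → ℕ) (b : Fin r → ℕ),
      (Nat.gcd (Finset.univ.gcd fun i => a i - 1)
            (Nat.gcd (Finset.univ.gcd fun j => b j) (p ^ m)) : ℤ)
      = ∑ d ∈ (p ^ m).divisors, (Nat.totient d : ℤ) *
          ((if ∀ i, d ∣ a i - 1 then 1 else 0) * (if ∀ j, d ∣ b j then 1 else 0)) := by
    intro a b
    rw [msp_gcd_expand (p ^ m) _ hn ((Nat.gcd_dvd_right _ _).trans (Nat.gcd_dvd_right _ _))]
    refine Finset.sum_congr rfl fun d hd => ?_
    have hd' := Nat.dvd_of_mem_divisors hd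
    simp only [Nat.dvd_gcd_iff, Finset.dvd_gcd_iff, Finset.mem_univ, true_implies, hd', and_true]
    by_cases h1 : ∀ i, d ∣ a i - 1 <;> by_cases h2 : ∀ j, d ∣ b j <;> simp [h1, h2]
  simp_rw [key]
  have swap : ∀ (S : Finset (Fin s → ℕ)) (T : Finset (Fin r → ℕ)),
      ∑ a ∈ S, ∑ b ∈ T, ∑ d ∈ (p ^ m).divisors, (Nat.totient d : ℤ) *
          ((if ∀ i, d ∣ a i - 1 then (1 : ℤ) else 0) * (if ∀ j, d ∣ b j then (1 : ℤ) else 0))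
      = ∑ d ∈ (p ^ m).divisors, (Nat.totient d : ℤ) *
          ((∑ a ∈ S, if ∀ i, d ∣ a i - 1 then (1 : ℤ) else 0) *
            (∑ b ∈ T, if ∀ j, d ∣ b j then (1 : ℤ) else 0)) := by
    intro S T
    simp_rw [Finset.sum_mul_sum, Finset.mul_sum]
    rw [Finset.sum_comm (s := (p ^ m).divisors)]
    refine Finset.sum_congr rfl fun a _ => ?_
    rw [Finset.sum_comm]
  rw [swap]
  have h1 : ∀ d, _ := fun d => msp_sum_pi s
    ((Finset.Icc 1 (p ^ m)).filter fun x => Nat.Coprime x p) (fun x => d ∣ x - 1)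
  have h2 : ∀ d, _ := fun d => msp_sum_pi r (Finset.Icc 1 (p ^ m)) (fun x => d ∣ x)
  simp_rw [h1, h2]
  rw [Nat.sum_divisors_prime_pow hp, Nat.sum_divisors_prime_pow hp, Finset.sum_range_succ',
    Finset.sum_range_succ]
  have e0 : (Finset.filter (fun x => p ^ 0 ∣ x - 1)
      ((Finset.Icc 1 (p ^ m)).filter fun x => Nat.Coprime x p)) =
      (Finset.Icc 1 (p ^ m)).filter fun x => Nat.Coprime x p := by simp
  rw [e0, msp_count_one p m hm, msp_count_b p m 0 hp (Nat.zero_le _)]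
  have e1 : ∀ k ∈ Finset.range m,
      (Nat.totient (p ^ (k + 1)) : ℤ) *
      ((#(((Finset.Icc 1 (p ^ m)).filter fun x => Nat.Coprime x p).filter
          fun x => p ^ (k + 1) ∣ x - 1) : ℤ) ^ s *
        (#((Finset.Icc 1 (p ^ m)).filter fun x => p ^ (k + 1) ∣ x) : ℤ) ^ r)
      = (Nat.totient (p ^ m) : ℤ) * ((p ^ (m - 1 - k) : ℕ) : ℤ) ^ (s + r - 1) := by
    intro k hk
    have hk := Finset.mem_range.1 hk
    rw [msp_count_a p m (k + 1) hp (by omega) (by omega), msp_count_b p m (k + 1) hp (by omega)]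
    obtain ⟨t, rfl⟩ : ∃ t, m = k + 1 + t := ⟨m - (k + 1), by omega⟩
    obtain ⟨u, rfl⟩ : ∃ u, s = u + 1 := ⟨s - 1, by omega⟩
    rw [Nat.totient_prime_pow_succ hp, Nat.totient_prime_pow hp (by omega)]
    have a1 : k + 1 + t - (k + 1) = t := by omega
    have a2 : k + 1 + t - 1 - k = t := by omega
    have a3 : k + 1 + t - 1 = k + t := by omega
    have a4 : u + 1 + r - 1 = u + r := by omega
    rw [a1, a2, a3, a4]
    push_cast
    ring
  rw [Finset.sum_congr rfl e1, ← Finset.mul_sum,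
    Finset.sum_range_reflect (fun k => ((p ^ k : ℕ) : ℤ) ^ (s + r - 1)) m]
  obtain ⟨u, rfl⟩ : ∃ u, s = u + 1 := ⟨s - 1, by omega⟩
  simp only [Nat.add_sub_cancel, Nat.sub_zero, pow_zero, Nat.totient_one]
  push_cast
  rw [pow_mul, pow_mul]
  ring
end

section
/- Let n = p^m be a prime power, let χ₁, …, χ_s be Dirichlet characters modulo n with conductors p^{t_1}, …, p^{t_s} (0 ≤ t_i ≤ m), set u = max(t₁, …, t_s), and let 0 ≤ k ≤ m be an integer with k < u. Then ∑ gcd(a₁−1, …, a_s−1, p^k)·χ₁(a₁)⋯χ_s(a_s), where a₁, …, a_s range over integers in [1,p^m] coprime to p, equals 0. -/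
open Finset

/-- the character-twisted gcd sum vanishes when `k < u = max t_i`. -/
theorem twisted_gcd_sum_eq_zero_of_lt_max_conductor_exponent
    (p m s k : ℕ) (hp : p.Prime) (hm : 0 < m) (hs : 0 < s)
    (χ : Fin s → DirichletCharacter ℂ (p ^ m))
    (t : Fin s → ℕ) (ht : ∀ i, (χ i).conductor = p ^ t i) (htm : ∀ i, t i ≤ m)
    (u : ℕ) (hu : u = Finset.univ.sup t)
    (hk : k ≤ m) (hku : k < u) :
    ∑ a ∈ Fintype.piFinset
        (fun _ : Fin s => (Finset.Icc 1 (p ^ m)).filter fun x => Nat.Coprime x p),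
      (Nat.gcd (Finset.univ.gcd fun i => a i - 1) (p ^ k) : ℂ) * ∏ i, χ i (a i) = 0 := by
  have hpm : 1 < p ^ m := Nat.one_lt_pow hm.ne' hp.one_lt
  haveI : NeZero (p ^ m) := ⟨by omega⟩
  haveI : Fact (1 < p ^ m) := ⟨hpm⟩
  have hdvd : p ^ k ∣ p ^ m := pow_dvd_pow p hk
  obtain ⟨j, hj⟩ : ∃ j, k < t j := by
    rw [hu, Finset.lt_sup_iff] at hku
    obtain ⟨j, -, hj⟩ := hku
    exact ⟨j, hj⟩
  -- a unit congruent to one mod `p ^ k` on which the character is nontrivial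
  obtain ⟨v, hv1, hv2⟩ : ∃ v : (ZMod (p ^ m))ˣ, ZMod.unitsMap hdvd v = 1 ∧ χ j v ≠ 1 := by
    by_contra! hcon
    have hf : (χ j).FactorsThrough (p ^ k) := by
      rw [DirichletCharacter.factorsThrough_iff_ker_unitsMap hdvd]
      intro x hx
      rw [MonoidHom.mem_ker] at hx ⊢
      ext
      simpa using hcon x hx
    have h2 : (χ j).conductor ≤ p ^ k := Nat.sInf_le hf
    rw [ht j] at h2
    exact absurd h2 (not_le.mpr (Nat.pow_lt_pow_right hp.one_lt hj))
  have hval : ∀ x : (ZMod (p ^ m))ˣ, 1 ≤ (x : ZMod (p ^ m)).val := by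
    intro x
    rw [Nat.one_le_iff_ne_zero, Ne, ZMod.val_eq_zero]
    exact x.ne_zero
  let F : (Fin s → (ZMod (p ^ m))ˣ) → ℂ := fun x =>
    (Nat.gcd (Finset.univ.gcd fun i => (x i : ZMod (p ^ m)).val - 1) (p ^ k) : ℂ)
      * ∏ i, χ i (x i)
  have hsum : ∑ a ∈ Fintype.piFinset
        (fun _ : Fin s => (Finset.Icc 1 (p ^ m)).filter fun x => Nat.Coprime x p),
      (Nat.gcd (Finset.univ.gcd fun i => a i - 1) (p ^ k) : ℂ) * ∏ i, χ i (a i)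
      = ∑ x, F x := by
    symm
    refine Finset.sum_bij (fun x _ i => (x i : ZMod (p ^ m)).val) ?_ ?_ ?_ ?_
    · intro x _
      simp only [Fintype.mem_piFinset, Finset.mem_filter, Finset.mem_Icc]
      intro i
      refine ⟨⟨hval _, (ZMod.val_lt _).le⟩, ?_⟩
      exact Nat.Coprime.coprime_dvd_right (dvd_pow_self p hm.ne') (ZMod.val_coe_unit_coprime (x i))
    · intro x _ y _ hxy
      funext i
      exact Units.ext (ZMod.val_injective _ (congrFun hxy i))
    · intro a ha
      simp only [Fintype.mem_piFinset, Finset.mem_filter, Finset.mem_Icc] at ha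
      refine ⟨fun i => ZMod.unitOfCoprime (a i) ((ha i).2.pow_right m), Finset.mem_univ _, ?_⟩
      funext i
      have hne : a i ≠ p ^ m := by
        intro h
        have h3 := (ha i).2
        rw [h, Nat.coprime_pow_left_iff hm, Nat.coprime_self] at h3
        exact hp.one_lt.ne' h3
      rw [ZMod.coe_unitOfCoprime, ZMod.val_natCast, Nat.mod_eq_of_lt]
      exact lt_of_le_of_ne (ha i).1.2 hne
    · intro x _
      simp [F]
  -- divisibility criterion
  have hcrit : ∀ (d : ℕ), d ∣ p ^ k → ∀ x : (ZMod (p ^ m))ˣ,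
      (d ∣ (x : ZMod (p ^ m)).val - 1 ↔ (((x : ZMod (p ^ m)).val : ℕ) : ZMod d) = 1) := by
    intro d _ x
    rw [← ZMod.natCast_eq_zero_iff, Nat.cast_sub (hval x), Nat.cast_one, sub_eq_zero]
  have hvd : ∀ d : ℕ, d ∣ p ^ k → (((v : ZMod (p ^ m)).val : ℕ) : ZMod d) = 1 := by
    intro d hd
    have h := congrArg (fun y : (ZMod (p ^ k))ˣ => (y : ZMod (p ^ k))) hv1
    simp only [ZMod.unitsMap_val, Units.val_one] at h
    have h2 := congrArg (ZMod.castHom hd (ZMod d)) h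
    rw [ZMod.cast_eq_val, map_natCast, map_one] at h2
    exact h2
  have hinv : ∀ x, F (Pi.mulSingle j v * x) = χ j v * F x := by
    intro x
    have hg : Nat.gcd (Finset.univ.gcd fun i =>
          (((Pi.mulSingle j v * x : Fin s → (ZMod (p ^ m))ˣ) i : (ZMod (p ^ m))ˣ)
            : ZMod (p ^ m)).val - 1) (p ^ k)
        = Nat.gcd (Finset.univ.gcd fun i => (x i : ZMod (p ^ m)).val - 1) (p ^ k) := by
      refine Nat.dvd_left_iff_eq.mp ?_
      intro d
      rw [Nat.dvd_gcd_iff, Nat.dvd_gcd_iff, and_congr_left_iff]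
      intro hd
      rw [Finset.dvd_gcd_iff, Finset.dvd_gcd_iff]
      refine forall_congr' fun i => forall_congr' fun _ => ?_
      rw [hcrit d hd, hcrit d hd]
      have : (((((Pi.mulSingle j v * x : Fin s → (ZMod (p ^ m))ˣ) i : (ZMod (p ^ m))ˣ)
            : ZMod (p ^ m)).val : ℕ) : ZMod d) = (((x i : ZMod (p ^ m)).val : ℕ) : ZMod d) := by
        by_cases hij : i = j
        · subst hij
          have e := map_mul (ZMod.castHom (hd.trans hdvd) (ZMod d)) (v : ZMod (p ^ m)) (x i)
          simp only [ZMod.castHom_apply, ZMod.cast_eq_val] at e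
          rw [hvd d hd, one_mul] at e
          simpa using e
        · simp [Pi.mulSingle_eq_of_ne hij]
      rw [this]
    have hpr : ∏ i, χ i ((Pi.mulSingle j v * x : Fin s → (ZMod (p ^ m))ˣ) i : (ZMod (p ^ m))ˣ)
        = χ j v * ∏ i, χ i (x i) := by
      simp only [Pi.mul_apply, Units.val_mul, map_mul, Finset.prod_mul_distrib]
      congr 1
      rw [Finset.prod_eq_single j]
      · simp
      · intro b _ hb
        simp [Pi.mulSingle_eq_of_ne hb]
      · simp
    simp only [F]
    rw [hg, hpr]
    ring
  have hS : ∑ x, F x = χ j v * ∑ x, F x := by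
    rw [Finset.mul_sum, ← Equiv.sum_comp (Equiv.mulLeft (Pi.mulSingle j v)) F]
    exact Finset.sum_congr rfl fun x _ => hinv x
  rw [hsum]
  have h0 : (χ j v - 1) * ∑ x, F x = 0 := by linear_combination -hS
  exact (mul_eq_zero.mp h0).resolve_left (sub_ne_zero.mpr hv2)
end

section
/- Let n = p^m be a prime power, let χ₁, …, χ_s be Dirichlet characters modulo n with conductors p^{t_1}, …, p^{t_s} (0 ≤ t_i ≤ m), set u = max(t₁, …, t_s), and let k be an integer with u ≤ k ≤ m and u > 0. Then ∑ gcd(a₁−1, …, a_s−1, p^k)·χ₁(a₁)⋯χ_s(a_s), where a₁, …, a_s range over integers in [1,p^m] coprime to p, equals φ(p^m)·p^{(m−k)(s−1)}·σ_{s−1}(p^{k−u}). -/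
open Finset

/-- The one-variable sum: characters summed over `x ≡ 1 mod p ^ j`. -/
noncomputable def oneVarSum (p m j : ℕ) (χ : DirichletCharacter ℂ (p ^ m)) : ℂ :=
  ∑ x ∈ (Finset.Icc 1 (p ^ m)).filter (fun x => Nat.Coprime x p),
    if p ^ j ∣ x - 1 then χ (x : ZMod (p ^ m)) else 0

lemma dvd_sub_one_iff_cast (d x : ℕ) (hx : 1 ≤ x) : d ∣ x - 1 ↔ (x : ZMod d) = 1 := by
  rw [← ZMod.natCast_eq_zero_iff, Nat.cast_sub hx, sub_eq_zero, Nat.cast_one]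

lemma oneVarSum_eq_zmod (p m j : ℕ) (hp : p.Prime) (hm : 0 < m) (hj : j ≤ m)
    [NeZero (p ^ m)] (χ : DirichletCharacter ℂ (p ^ m)) :
    oneVarSum p m j χ = ∑ x : ZMod (p ^ m),
      if ZMod.castHom (pow_dvd_pow p hj) (ZMod (p ^ j)) x = 1 then χ x else 0 := by
  have hpos : 0 < p ^ m := pow_pos hp.pos m
  unfold oneVarSum
  rw [Finset.sum_filter]
  refine Finset.sum_nbij (fun x => (x : ZMod (p ^ m))) (by simp) ?_ ?_ ?_
  · intro x hx y hy hxy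
    simp only [Finset.coe_Icc, Set.mem_Icc] at hx hy
    have h1 : (x : ZMod (p ^ m)) = y := hxy
    rw [ZMod.natCast_eq_natCast_iff] at h1
    have h2 : (x - 1) + 1 ≡ (y - 1) + 1 [MOD p ^ m] := by
      rwa [Nat.sub_add_cancel hx.1, Nat.sub_add_cancel hy.1]
    have h3 := Nat.ModEq.eq_of_lt_of_lt (Nat.ModEq.add_right_cancel' 1 h2) (by omega) (by omega)
    omega
  · intro z _
    by_cases hz : z = 0
    · refine ⟨p ^ m, by simp; omega, ?_⟩
      simp only [hz, ZMod.natCast_self]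
    · refine ⟨z.val, ?_, by simp⟩
      have h1 := ZMod.val_lt z
      have h2 : z.val ≠ 0 := by rwa [Ne, ZMod.val_eq_zero]
      simp only [Finset.coe_Icc, Set.mem_Icc]
      omega
  · intro x hx
    have hx1 := (Finset.mem_Icc.mp hx).1
    simp only [map_natCast, dvd_sub_one_iff_cast _ _ hx1]
    split_ifs with h1 h2 <;> try rfl
    symm
    apply MulChar.map_nonunit
    rw [ZMod.isUnit_iff_coprime]
    intro h3
    exact h1 ((Nat.coprime_pow_right_iff hm _ _).mp h3)

lemma oneVarSum_eq_zero (p m j t : ℕ) (hp : p.Prime) (hm : 0 < m) (hj : j ≤ m)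
    (χ : DirichletCharacter ℂ (p ^ m)) (ht : χ.conductor = p ^ t) (hjt : j < t) :
    oneVarSum p m j χ = 0 := by
  haveI : NeZero (p ^ m) := ⟨(pow_pos hp.pos m).ne'⟩
  have hnf : ¬ χ.FactorsThrough (p ^ j) := by
    intro h
    have h1 : χ.conductor ≤ p ^ j := Nat.sInf_le h
    rw [ht] at h1
    exact absurd h1 (not_le.mpr (Nat.pow_lt_pow_right hp.one_lt hjt))
  rw [DirichletCharacter.factorsThrough_iff_ker_unitsMap (pow_dvd_pow p hj),
    SetLike.not_le_iff_exists] at hnf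
  obtain ⟨v, hv1, hv2⟩ := hnf
  have hv3 : ZMod.castHom (pow_dvd_pow p hj) (ZMod (p ^ j)) (v : ZMod (p ^ m)) = 1 := by
    have := congrArg Units.val (MonoidHom.mem_ker.mp hv1)
    simpa [ZMod.unitsMap_def] using this
  have hv4 : χ v ≠ 1 := by
    intro h
    apply hv2
    rw [MonoidHom.mem_ker, Units.ext_iff, MulChar.coe_toUnitHom, Units.val_one, h]
  rw [oneVarSum_eq_zmod p m j hp hm hj]
  set f : ZMod (p ^ m) → ℂ := fun x =>
    if ZMod.castHom (pow_dvd_pow p hj) (ZMod (p ^ j)) x = 1 then χ x else 0 with hf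
  change ∑ x, f x = 0
  have h1 : ∑ x, f (v * x) = ∑ x, f x := Equiv.sum_comp (Units.mulLeft v) f
  have h2 : ∀ x, f (v * x) = χ v * f x := by
    intro x
    simp only [hf, map_mul, hv3, one_mul]
    split_ifs <;> simp
  simp only [h2, ← Finset.mul_sum] at h1
  have h3 : (χ v - 1) * ∑ x, f x = 0 := by rw [sub_mul, h1]; ring
  exact (mul_eq_zero.mp h3).resolve_left (sub_ne_zero.mpr hv4)

lemma oneVarSum_eq_pow (p m j t : ℕ) (hp : p.Prime) (hm : 0 < m) (hj0 : 0 < j) (hj : j ≤ m)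
    (χ : DirichletCharacter ℂ (p ^ m)) (ht : χ.conductor = p ^ t) (hjt : t ≤ j) :
    oneVarSum p m j χ = (p : ℂ) ^ (m - j) := by
  haveI : NeZero (p ^ m) := ⟨(pow_pos hp.pos m).ne'⟩
  have hF : χ.FactorsThrough (p ^ j) := by
    have h := χ.factorsThrough_conductor
    rw [ht] at h
    exact DirichletCharacter.FactorsThrough.mono χ h (pow_dvd_pow p hjt) (pow_dvd_pow p hj)
  rw [DirichletCharacter.factorsThrough_iff_ker_unitsMap (pow_dvd_pow p hj)] at hF
  have hcop : ∀ x, 1 ≤ x → p ^ j ∣ x - 1 → Nat.Coprime x p := by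
    intro x hx hd
    rw [Nat.coprime_comm, hp.coprime_iff_not_dvd]
    intro h
    have h1 : p ∣ x - 1 := (dvd_pow_self p hj0.ne').trans hd
    have h2 : p ∣ 1 := by
      have := Nat.dvd_sub h h1
      rwa [Nat.sub_sub_self hx] at this
    exact hp.one_lt.ne' (Nat.dvd_one.mp h2)
  unfold oneVarSum
  have h1 : ∀ x ∈ (Finset.Icc 1 (p ^ m)).filter (fun x => Nat.Coprime x p),
      (if p ^ j ∣ x - 1 then χ (x : ZMod (p ^ m)) else 0) = if p ^ j ∣ x - 1 then (1 : ℂ) else 0 := by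
    intro x hx
    rw [Finset.mem_filter, Finset.mem_Icc] at hx
    split_ifs with hd
    · have hc : Nat.Coprime x (p ^ m) := hx.2.pow_right m
      have h2 : ZMod.unitOfCoprime x hc ∈ (ZMod.unitsMap (pow_dvd_pow p hj)).ker := by
        rw [MonoidHom.mem_ker, Units.ext_iff]
        simpa [ZMod.unitsMap_def] using (dvd_sub_one_iff_cast _ _ hx.1.1).mp hd
      have h3 := hF h2
      rw [MonoidHom.mem_ker, Units.ext_iff, MulChar.coe_toUnitHom, Units.val_one,
        ZMod.coe_unitOfCoprime] at h3
      exact h3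
    · rfl
  rw [Finset.sum_congr rfl h1, ← Finset.sum_filter, Finset.filter_filter, Finset.sum_const,
    nsmul_eq_mul, mul_one, ← Nat.cast_pow]
  congr 1
  have hpj : 0 < p ^ j := pow_pos hp.pos j
  have hmul : p ^ m = p ^ j * p ^ (m - j) := by rw [← pow_add]; congr 1; omega
  have : (Finset.Icc 1 (p ^ m)).filter (fun x => Nat.Coprime x p ∧ p ^ j ∣ x - 1)
      = (Finset.range (p ^ (m - j))).image (fun b => p ^ j * b + 1) := by
    ext x
    simp only [Finset.mem_filter, Finset.mem_Icc, Finset.mem_image, Finset.mem_range]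
    constructor
    · rintro ⟨⟨hx1, hx2⟩, -, b, hb⟩
      refine ⟨b, ?_, by omega⟩
      rw [hmul] at hx2
      exact Nat.lt_of_mul_lt_mul_left (a := p ^ j) (by omega)
    · rintro ⟨b, hb, rfl⟩
      have hd : p ^ j ∣ p ^ j * b + 1 - 1 := by simp
      refine ⟨⟨by omega, ?_⟩, hcop _ (by omega) hd, hd⟩
      rw [hmul]
      exact Nat.mul_lt_mul_of_pos_left hb hpj
  rw [this, Finset.card_image_of_injective, Finset.card_range]
  intro b c hbc
  exact Nat.eq_of_mul_eq_mul_left hpj (Nat.add_right_cancel hbc)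

lemma gcd_pow_eq_sum (p k g : ℕ) (hp : p.Prime) :
    Nat.gcd g (p ^ k) = ∑ j ∈ Finset.range (k + 1), if p ^ j ∣ g then Nat.totient (p ^ j) else 0 := by
  have hpk : p ^ k ≠ 0 := (pow_pos hp.pos k).ne'
  have h1 : (Nat.gcd g (p ^ k)).divisors = (p ^ k).divisors.filter (fun d => d ∣ g) := by
    ext d
    simp only [Nat.mem_divisors, Finset.mem_filter, Nat.dvd_gcd_iff]
    constructor
    · rintro ⟨⟨a, b⟩, -⟩
      exact ⟨⟨b, hpk⟩, a⟩
    · rintro ⟨⟨b, -⟩, a⟩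
      exact ⟨⟨a, b⟩, Nat.gcd_ne_zero_right hpk⟩
  conv_lhs => rw [← Nat.sum_totient (Nat.gcd g (p ^ k)), h1, Finset.sum_filter,
    Nat.divisors_prime_pow hp, Finset.sum_map]
  rfl

/-- the character-twisted gcd sum for `u ≤ k ≤ m` with `u > 0`. -/
theorem twisted_gcd_sum_of_max_conductor_exponent_le
    (p m s k : ℕ) (hp : p.Prime) (hm : 0 < m) (hs : 0 < s)
    (χ : Fin s → DirichletCharacter ℂ (p ^ m))
    (t : Fin s → ℕ) (ht : ∀ i, (χ i).conductor = p ^ t i) (htm : ∀ i, t i ≤ m)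
    (u : ℕ) (hu : u = Finset.univ.sup t)
    (hu0 : 0 < u) (huk : u ≤ k) (hk : k ≤ m) :
    ∑ a ∈ Fintype.piFinset
        (fun _ : Fin s => (Finset.Icc 1 (p ^ m)).filter fun x => Nat.Coprime x p),
      (Nat.gcd (Finset.univ.gcd fun i => a i - 1) (p ^ k) : ℂ) * ∏ i, χ i (a i)
    = (Nat.totient (p ^ m) : ℂ) * (p : ℂ) ^ ((m - k) * (s - 1)) *
        ∑ e ∈ (p ^ (k - u)).divisors, (e : ℂ) ^ (s - 1) := by
  have hA : ∀ a : Fin s → ℕ,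
      (Nat.gcd (Finset.univ.gcd fun i => a i - 1) (p ^ k) : ℂ) * ∏ i, χ i (a i)
      = ∑ j ∈ Finset.range (k + 1), (Nat.totient (p ^ j) : ℂ) *
          ∏ i, (if p ^ j ∣ a i - 1 then χ i (a i) else 0) := by
    intro a
    rw [gcd_pow_eq_sum p k _ hp, Nat.cast_sum, Finset.sum_mul]
    refine Finset.sum_congr rfl fun j _ => ?_
    rw [Finset.prod_ite_zero]
    simp only [Finset.dvd_gcd_iff]
    split_ifs <;> simp
  simp only [hA]
  rw [Finset.sum_comm]
  simp only [← Finset.mul_sum]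
  have hB : ∀ j, ∑ a ∈ Fintype.piFinset
        (fun _ : Fin s => (Finset.Icc 1 (p ^ m)).filter fun x => Nat.Coprime x p),
      ∏ i, (if p ^ j ∣ a i - 1 then χ i (a i) else 0) = ∏ i, oneVarSum p m j (χ i) := by
    intro j
    exact Finset.sum_prod_piFinset
      ((Finset.Icc 1 (p ^ m)).filter fun x => Nat.Coprime x p)
      (fun i x => if p ^ j ∣ x - 1 then χ i (x : ZMod (p ^ m)) else 0)
  simp only [hB]
  haveI : Nonempty (Fin s) := ⟨⟨0, hs⟩⟩
  obtain ⟨i₀, -, hi₀⟩ := Finset.exists_mem_eq_sup (Finset.univ : Finset (Fin s))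
    Finset.univ_nonempty t
  have hle : ∀ i, t i ≤ u := fun i => hu ▸ Finset.le_sup (Finset.mem_univ i)
  have hsmall : ∀ j, j < u → ∏ i, oneVarSum p m j (χ i) = 0 := by
    intro j hj
    apply Finset.prod_eq_zero (Finset.mem_univ i₀)
    have h1 : t i₀ = u := by rw [hu, hi₀]
    exact oneVarSum_eq_zero p m j (t i₀) hp hm (by omega) _ (ht i₀) (by omega)
  have hbig : ∀ j, u ≤ j → j ≤ k →
      (Nat.totient (p ^ j) : ℂ) * ∏ i, oneVarSum p m j (χ i) =
      (Nat.totient (p ^ m) : ℂ) * (p : ℂ) ^ ((m - k) * (s - 1)) * ((p : ℂ) ^ (k - j)) ^ (s - 1) := by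
    intro j hj hjk
    rw [Finset.prod_congr rfl fun i _ => oneVarSum_eq_pow p m j (t i) hp hm (by omega) (by omega)
      (χ i) (ht i) ((hle i).trans hj), Finset.prod_const, Finset.card_univ, Fintype.card_fin,
      Nat.totient_prime_pow hp (by omega), Nat.totient_prime_pow hp hm]
    obtain ⟨s, rfl⟩ : ∃ r, s = r + 1 := ⟨s - 1, by omega⟩
    obtain ⟨j, rfl⟩ : ∃ r, j = r + 1 := ⟨j - 1, by omega⟩
    obtain ⟨b, rfl⟩ := Nat.exists_eq_add_of_le hjk
    obtain ⟨c, rfl⟩ := Nat.exists_eq_add_of_le hk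
    have e1 : j + 1 + b + c - (j + 1) = b + c := by omega
    have e2 : j + 1 + b + c - 1 = j + b + c := by omega
    have e3 : j + 1 + b + c - (j + 1 + b) = c := by omega
    have e4 : j + 1 + b - (j + 1) = b := by omega
    simp only [e1, e2, e3, e4, Nat.add_sub_cancel, Nat.cast_mul, Nat.cast_pow]
    ring
  rw [Nat.divisors_prime_pow hp, Finset.sum_map, Finset.mul_sum,
    ← Finset.sum_range_reflect]
  simp only [Function.Embedding.coeFn_mk, Nat.cast_pow]
  have hsplit : k + 1 = u + (k - u + 1) := by omega
  conv_rhs => rw [← Finset.sum_range_reflect]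
  rw [Finset.sum_range_reflect (fun j => (Nat.totient (p ^ j) : ℂ) * ∏ i, oneVarSum p m j (χ i)),
    hsplit, Finset.sum_range_add, Finset.sum_eq_zero, zero_add]
  · refine Finset.sum_congr rfl fun j hj => ?_
    rw [Finset.mem_range] at hj
    rw [hbig (u + j) (by omega) (by omega)]
    congr 3
    omega
  · intro j hj
    rw [hsmall j (Finset.mem_range.mp hj), mul_zero]
end

section
/- Let n = n₁·n₂ with gcd(n₁, n₂) = 1, and let χ₁, …, χ_s be Dirichlet characters modulo n. Write each χ_i = χ_i^{(1)}·χ_i^{(2)} with χ_i^{(1)} a Dirichlet character modulo n₁ and χ_i^{(2)} a Dirichlet character modulo n₂ (via the Chinese remainder theorem isomorphism (ℤ/nℤ)* ≅ (ℤ/n₁ℤ)* × (ℤ/n₂ℤ)*). Define S_{χ₁,…,χ_s}(n, r) = ∑ gcd(a₁−1, …, a_s−1, b₁, …, b_r, n)·χ₁(a₁)⋯χ_s(a_s), where a₁, …, a_s range over integers in [1,n] coprime to n and b₁, …, b_r range over integers in [1,n]. Then S_{χ₁,…,χ_s}(n, r) = S_{χ₁^{(1)},…,χ_s^{(1)}}(n₁,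 r) · S_{χ₁^{(2)},…,χ_s^{(2)}}(n₂, r). -/
open Finset

/-- Representative of `x` modulo `m` in `[1, m]`. -/
def msRed (m x : ℕ) : ℕ := if x % m = 0 then m else x % m

theorem msRed_mem {m : ℕ} (hm : 0 < m) (x : ℕ) : msRed m x ∈ Finset.Icc 1 m := by
  have := Nat.mod_lt x hm
  unfold msRed
  split_ifs <;> simp <;> omega

theorem msRed_modEq (m x : ℕ) : msRed m x ≡ x [MOD m] := by
  unfold msRed Nat.ModEq
  split_ifs with h
  · simp [h]
  · simp

theorem ms_uniq {m x y : ℕ} (hx : x ∈ Finset.Icc 1 m) (hy : y ∈ Finset.Icc 1 m)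
    (h : x ≡ y [MOD m]) : x = y := by
  simp only [Finset.mem_Icc] at hx hy
  have h1 : (x - 1) + 1 ≡ (y - 1) + 1 [MOD m] := by
    rwa [Nat.sub_add_cancel hx.1, Nat.sub_add_cancel hy.1]
  have h2 := Nat.ModEq.add_right_cancel' 1 h1
  have := Nat.ModEq.eq_of_lt_of_lt h2 (by omega) (by omega)
  omega

theorem ms_sub {m x y : ℕ} (hx : 1 ≤ x) (hy : 1 ≤ y)
    (h : x ≡ y [MOD m]) : x - 1 ≡ y - 1 [MOD m] := by
  have h1 : (x - 1) + 1 ≡ (y - 1) + 1 [MOD m] := by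
    rwa [Nat.sub_add_cancel hx, Nat.sub_add_cancel hy]
  exact Nat.ModEq.add_right_cancel' 1 h1

theorem ms_cop {m x y : ℕ} (h : x ≡ y [MOD m]) : Nat.Coprime x m ↔ Nat.Coprime y m := by
  unfold Nat.Coprime
  rw [h.gcd_eq]

theorem ms_gcd_dvd {m s r : ℕ} {a a' : Fin s → ℕ} {b b' : Fin r → ℕ}
    (ha : ∀ i, a i ≡ a' i [MOD m]) (hb : ∀ i, b i ≡ b' i [MOD m]) :
    Nat.gcd (Finset.univ.gcd a) (Nat.gcd (Finset.univ.gcd b) m) ∣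
    Nat.gcd (Finset.univ.gcd a') (Nat.gcd (Finset.univ.gcd b') m) := by
  set d := Nat.gcd (Finset.univ.gcd a) (Nat.gcd (Finset.univ.gcd b) m) with hd
  have hda : d ∣ Finset.univ.gcd a := Nat.gcd_dvd_left _ _
  have hdr : d ∣ Nat.gcd (Finset.univ.gcd b) m := Nat.gcd_dvd_right _ _
  have hdb : d ∣ Finset.univ.gcd b := hdr.trans (Nat.gcd_dvd_left _ _)
  have hdm : d ∣ m := hdr.trans (Nat.gcd_dvd_right _ _)
  refine Nat.dvd_gcd (Finset.dvd_gcd fun i _ => ?_)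
    (Nat.dvd_gcd (Finset.dvd_gcd fun i _ => ?_) hdm)
  · exact ((ha i).dvd_iff hdm).1 (hda.trans (Finset.gcd_dvd (Finset.mem_univ i)))
  · exact ((hb i).dvd_iff hdm).1 (hdb.trans (Finset.gcd_dvd (Finset.mem_univ i)))

theorem ms_gcd_eq {m s r : ℕ} {a a' : Fin s → ℕ} {b b' : Fin r → ℕ}
    (ha : ∀ i, a i ≡ a' i [MOD m]) (hb : ∀ i, b i ≡ b' i [MOD m]) :
    Nat.gcd (Finset.univ.gcd a) (Nat.gcd (Finset.univ.gcd b) m) =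
    Nat.gcd (Finset.univ.gcd a') (Nat.gcd (Finset.univ.gcd b') m) :=
  Nat.dvd_antisymm (ms_gcd_dvd ha hb) (ms_gcd_dvd (fun i => (ha i).symm) (fun i => (hb i).symm))

/-- the Menon–Sury sum with several Dirichlet characters is
multiplicative with respect to a coprime factorization `n = n₁ * n₂` of the
modulus, where each `χ i` factors as a product of characters mod `n₁` and mod `n₂`. -/
theorem menon_sury_sum_multiplicative
    (n₁ n₂ s r : ℕ) (hn₁ : 0 < n₁) (hn₂ : 0 < n₂) (hcop : Nat.Coprime n₁ n₂)
    (χ : Fin s → DirichletCharacter ℂ (n₁ * n₂))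
    (χ₁ : Fin s → DirichletCharacter ℂ n₁)
    (χ₂ : Fin s → DirichletCharacter ℂ n₂)
    (hfac : ∀ i, ∀ c : ℕ, Nat.Coprime c (n₁ * n₂) →
      χ i (c : ZMod (n₁ * n₂)) = χ₁ i (c : ZMod n₁) * χ₂ i (c : ZMod n₂)) :
    ∑ a ∈ Fintype.piFinset
        (fun _ : Fin s => (Finset.Icc 1 (n₁ * n₂)).filter fun x => Nat.Coprime x (n₁ * n₂)),
      ∑ b ∈ Fintype.piFinset (fun _ : Fin r => Finset.Icc 1 (n₁ * n₂)),
        (Nat.gcd (Finset.univ.gcd fun i => a i - 1)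
            (Nat.gcd (Finset.univ.gcd fun j => b j) (n₁ * n₂)) : ℂ) * ∏ i, χ i (a i)
    = (∑ a ∈ Fintype.piFinset
          (fun _ : Fin s => (Finset.Icc 1 n₁).filter fun x => Nat.Coprime x n₁),
        ∑ b ∈ Fintype.piFinset (fun _ : Fin r => Finset.Icc 1 n₁),
          (Nat.gcd (Finset.univ.gcd fun i => a i - 1)
              (Nat.gcd (Finset.univ.gcd fun j => b j) n₁) : ℂ) * ∏ i, χ₁ i (a i)) *
      (∑ a ∈ Fintype.piFinset
          (fun _ : Fin s => (Finset.Icc 1 n₂).filter fun x => Nat.Coprime x n₂),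
        ∑ b ∈ Fintype.piFinset (fun _ : Fin r => Finset.Icc 1 n₂),
          (Nat.gcd (Finset.univ.gcd fun i => a i - 1)
              (Nat.gcd (Finset.univ.gcd fun j => b j) n₂) : ℂ) * ∏ i, χ₂ i (a i)) := by
  have hn : 0 < n₁ * n₂ := Nat.mul_pos hn₁ hn₂
  have crt : ∀ {x y : ℕ}, x ∈ Finset.Icc 1 (n₁ * n₂) → y ∈ Finset.Icc 1 (n₁ * n₂) →
      msRed n₁ x = msRed n₁ y → msRed n₂ x = msRed n₂ y → x = y := by
    intro x y hx hy h1 h2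
    refine ms_uniq hx hy ((Nat.modEq_and_modEq_iff_modEq_mul hcop).1 ⟨?_, ?_⟩)
    · exact (msRed_modEq n₁ x).symm.trans (h1 ▸ msRed_modEq n₁ y)
    · exact (msRed_modEq n₂ x).symm.trans (h2 ▸ msRed_modEq n₂ y)
  have sur : ∀ u v : ℕ, ∃ z ∈ Finset.Icc 1 (n₁ * n₂), z ≡ u [MOD n₁] ∧ z ≡ v [MOD n₂] := by
    intro u v
    obtain ⟨k, hk1, hk2⟩ := Nat.chineseRemainder hcop u v
    have hz := (Nat.modEq_and_modEq_iff_modEq_mul hcop).2 (msRed_modEq (n₁ * n₂) k)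
    exact ⟨_, msRed_mem hn k, hz.1.trans hk1, hz.2.trans hk2⟩
  rw [← Finset.sum_product', ← Finset.sum_product', ← Finset.sum_product',
    Finset.sum_mul_sum, ← Finset.sum_product']
  refine Finset.sum_nbij (fun p => ((fun i => msRed n₁ (p.1 i), fun j => msRed n₁ (p.2 j)),
    (fun i => msRed n₂ (p.1 i), fun j => msRed n₂ (p.2 j)))) ?_ ?_ ?_ ?_
  · rintro ⟨a, b⟩ h
    simp only [Finset.mem_product, Fintype.mem_piFinset, Finset.mem_filter] at h ⊢
    refine ⟨⟨fun i => ⟨msRed_mem hn₁ _, ?_⟩, fun j => msRed_mem hn₁ _⟩,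
      ⟨fun i => ⟨msRed_mem hn₂ _, ?_⟩, fun j => msRed_mem hn₂ _⟩⟩
    · exact (ms_cop (msRed_modEq _ _)).2 (Nat.Coprime.coprime_mul_right_right (h.1 i).2)
    · exact (ms_cop (msRed_modEq _ _)).2 (Nat.Coprime.coprime_mul_left_right (h.1 i).2)
  · rintro ⟨a, b⟩ h ⟨a', b'⟩ h' he
    simp only [Finset.mem_coe, Finset.mem_product, Fintype.mem_piFinset,
      Finset.mem_filter] at h h'
    simp only [Prod.mk.injEq, funext_iff] at he ⊢
    exact ⟨fun i => crt (h.1 i).1 (h'.1 i).1 (he.1.1 i) (he.2.1 i),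
      fun j => crt (h.2 j) (h'.2 j) (he.1.2 j) (he.2.2 j)⟩
  · rintro ⟨⟨a₁, b₁⟩, ⟨a₂, b₂⟩⟩ h
    simp only [Finset.mem_coe, Finset.mem_product, Fintype.mem_piFinset,
      Finset.mem_filter] at h
    choose f hf hf1 hf2 using sur
    refine ⟨(fun i => f (a₁ i) (a₂ i), fun j => f (b₁ j) (b₂ j)), ?_, ?_⟩
    · simp only [Finset.mem_coe, Finset.mem_product, Fintype.mem_piFinset, Finset.mem_filter]
      refine ⟨fun i => ⟨hf _ _, Nat.Coprime.mul_right ?_ ?_⟩, fun j => hf _ _⟩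
      · exact (ms_cop (hf1 _ _)).2 (h.1.1 i).2
      · exact (ms_cop (hf2 _ _)).2 (h.2.1 i).2
    · simp only [Prod.mk.injEq, funext_iff]
      exact ⟨⟨fun i => ms_uniq (msRed_mem hn₁ _) (h.1.1 i).1
          ((msRed_modEq _ _).trans (hf1 _ _)),
        fun i => ms_uniq (msRed_mem hn₁ _) (h.1.2 i) ((msRed_modEq _ _).trans (hf1 _ _))⟩,
        ⟨fun i => ms_uniq (msRed_mem hn₂ _) (h.2.1 i).1
          ((msRed_modEq _ _).trans (hf2 _ _)),
        fun i => ms_uniq (msRed_mem hn₂ _) (h.2.2 i) ((msRed_modEq _ _).trans (hf2 _ _))⟩⟩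
  · rintro ⟨a, b⟩ h
    simp only [Finset.mem_product, Fintype.mem_piFinset, Finset.mem_filter] at h
    have one : ∀ {m : ℕ}, 0 < m → ∀ x, 1 ≤ msRed m x := fun hm x =>
      (Finset.mem_Icc.1 (msRed_mem hm x)).1
    have hg1 := ms_gcd_eq (m := n₁) (a := fun i => msRed n₁ (a i) - 1) (a' := fun i => a i - 1)
      (b := fun j => msRed n₁ (b j)) (b' := fun j => b j)
      (fun i => ms_sub (one hn₁ _) (Finset.mem_Icc.1 (h.1 i).1).1 (msRed_modEq _ _))
      (fun j => msRed_modEq _ _)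
    have hg2 := ms_gcd_eq (m := n₂) (a := fun i => msRed n₂ (a i) - 1) (a' := fun i => a i - 1)
      (b := fun j => msRed n₂ (b j)) (b' := fun j => b j)
      (fun i => ms_sub (one hn₂ _) (Finset.mem_Icc.1 (h.1 i).1).1 (msRed_modEq _ _))
      (fun j => msRed_modEq _ _)
    have hp : ∏ i, χ i (a i) = (∏ i, χ₁ i (msRed n₁ (a i) : ℕ)) *
        ∏ i, χ₂ i (msRed n₂ (a i) : ℕ) := by
      rw [← Finset.prod_mul_distrib]
      refine Finset.prod_congr rfl fun i _ => ?_
      rw [hfac i _ (h.1 i).2, (ZMod.natCast_eq_natCast_iff _ _ _).2 (msRed_modEq n₁ (a i)),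
        (ZMod.natCast_eq_natCast_iff _ _ _).2 (msRed_modEq n₂ (a i))]
    dsimp only
    rw [hg1, hg2, hp, ← Nat.gcd_assoc, Nat.Coprime.gcd_mul _ hcop, Nat.gcd_assoc, Nat.gcd_assoc]
    push_cast
    ring
end

section
/- Let n = p^m be a prime power, let χ₁, …, χ_s be Dirichlet characters modulo p^m, and let 0 ≤ k ≤ m. For 0 ≤ j ≤ m define U_j ⊆ (ℤ/p^mℤ)* as U_0 = (ℤ/p^mℤ)* and U_j = 1 + p^j·(ℤ/p^mℤ) for 1 ≤ j ≤ m. Then ∑ gcd(a₁−1, …, a_s−1, p^k)·χ₁(a₁)⋯χ_s(a_s), where a₁, …, a_s range over integers in [1,p^m] coprime to p, equals ∑_{(a₁,…,a_s) ∈ (U_0)^s} χ₁(a₁)⋯χ_s(a_s) + ∑_{j=1}^{k} (p^j − p^{j−1}) · ∑_{(a₁,…,a_s) ∈ (U_j)^s} χ₁(a₁)⋯χ_s(a_s). -/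
open Finset

lemma gcd_pow_telescope (p : ℕ) (hp : p.Prime) (G k : ℕ) :
    Nat.gcd G (p ^ k) = 1 + ∑ j ∈ Finset.Icc 1 k,
      (if p ^ j ∣ G then (p ^ j - p ^ (j - 1)) else 0) := by
  induction k with
  | zero => simp
  | succ k ih =>
    rw [Finset.sum_Icc_succ_top (by omega), ← add_assoc, ← ih]
    have hle : p ^ k ≤ p ^ (k + 1) := Nat.pow_le_pow_right hp.pos (by omega)
    split_ifs with h
    · have h' : p ^ k ∣ G := (pow_dvd_pow p (by omega)).trans h
      rw [Nat.gcd_eq_right h, Nat.gcd_eq_right h']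
      simp only [Nat.add_sub_cancel]
      omega
    · rw [add_zero]
      apply Nat.dvd_antisymm
      · obtain ⟨e, he, h1⟩ := (Nat.dvd_prime_pow hp).1 (Nat.gcd_dvd_right G (p ^ (k + 1)))
        apply Nat.dvd_gcd (Nat.gcd_dvd_left _ _)
        rw [h1]
        apply pow_dvd_pow
        by_contra hlt
        have : e = k + 1 := by omega
        subst this
        exact h (h1 ▸ Nat.gcd_dvd_left _ _)
      · exact Nat.gcd_dvd_gcd_of_dvd_right _ (pow_dvd_pow p (by omega))

lemma dvd_iff_exists_zmod (p m j : ℕ) [NeZero (p ^ m)] (hj : j ≤ m) (x : ℕ) (hx : 1 ≤ x) :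
    p ^ j ∣ x - 1 ↔ ∃ y : ZMod (p ^ m), (x : ZMod (p ^ m)) = 1 + (p : ZMod (p ^ m)) ^ j * y := by
  constructor
  · rintro ⟨t, ht⟩
    refine ⟨t, ?_⟩
    have : x = 1 + p ^ j * t := by omega
    rw [this]; push_cast; rfl
  · rintro ⟨y, hy⟩
    have h2 : ((x : ℕ) : ZMod (p ^ m)) = ((1 + p ^ j * y.val : ℕ) : ZMod (p ^ m)) := by
      push_cast
      rw [hy, ZMod.natCast_zmod_val]
    rw [ZMod.natCast_eq_natCast_iff] at h2
    have h3 : x ≡ 1 + p ^ j * y.val [MOD p ^ j] := h2.of_dvd (pow_dvd_pow p hj)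
    have h4 : 1 + p ^ j * y.val ≡ 1 [MOD p ^ j] := by
      simp [Nat.ModEq]
    exact (Nat.modEq_iff_dvd' hx).1 (h3.trans h4).symm

lemma sum_one_var (p m j : ℕ) (hp : p.Prime) (hm : 0 < m) [NeZero (p ^ m)] (hj : j ≤ m)
    (χ : DirichletCharacter ℂ (p ^ m)) (V : Finset (ZMod (p ^ m))ˣ)
    (hV : ∀ u : (ZMod (p ^ m))ˣ, u ∈ V ↔
      ∃ y : ZMod (p ^ m), (u : ZMod (p ^ m)) = 1 + (p : ZMod (p ^ m)) ^ j * y) :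
    ∑ x ∈ ((Finset.Icc 1 (p ^ m)).filter fun x => Nat.Coprime x p).filter
      (fun x => p ^ j ∣ x - 1), χ (x : ZMod (p ^ m)) = ∑ u ∈ V, χ (u : ZMod (p ^ m)) := by
  symm
  have hpos : ∀ u : (ZMod (p ^ m))ˣ, Nat.Coprime (u : ZMod (p ^ m)).val p := fun u =>
    Nat.Coprime.coprime_dvd_right (dvd_pow_self p hm.ne') (ZMod.val_coe_unit_coprime u)
  have h1 : ∀ u : (ZMod (p ^ m))ˣ, 1 ≤ (u : ZMod (p ^ m)).val := by
    intro u
    by_contra h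
    have h0 : (u : ZMod (p ^ m)).val = 0 := by omega
    have := hpos u
    rw [h0, Nat.coprime_zero_left] at this
    exact hp.one_lt.ne' this
  refine Finset.sum_nbij (fun u => (u : ZMod (p ^ m)).val) ?_ ?_ ?_ ?_
  · intro u hu
    simp only [Finset.mem_filter, Finset.mem_Icc]
    refine ⟨⟨⟨h1 u, (ZMod.val_lt _).le⟩, hpos u⟩, ?_⟩
    rw [dvd_iff_exists_zmod p m j hj _ (h1 u), ZMod.natCast_zmod_val]
    exact (hV u).1 hu
  · intro u _ v _ h
    exact Units.ext (ZMod.val_injective _ h)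
  · intro x hx
    simp only [Finset.coe_filter, Finset.mem_filter, Finset.mem_Icc, Set.mem_setOf_eq] at hx
    obtain ⟨⟨⟨hx1, hx2⟩, hx3⟩, hx4⟩ := hx
    have hne : x ≠ p ^ m := by
      rintro rfl
      have := Nat.Coprime.coprime_dvd_left (dvd_pow_self p hm.ne') hx3
      rw [Nat.coprime_self] at this
      exact hp.one_lt.ne' this
    refine ⟨ZMod.unitOfCoprime x (hx3.pow_right m), ?_, ?_⟩
    · rw [Finset.mem_coe, hV, ZMod.coe_unitOfCoprime]
      exact (dvd_iff_exists_zmod p m j hj _ hx1).1 hx4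
    · simp only [ZMod.coe_unitOfCoprime]
      exact ZMod.val_cast_of_lt (lt_of_le_of_ne hx2 hne)
  · intro u _
    simp only [ZMod.natCast_zmod_val]

/-- the twisted gcd sum expressed via sums over powers of the
filtration subgroups `U_0 = (ℤ/p^mℤ)*`, `U_j = 1 + p^j (ℤ/p^mℤ)`. -/
theorem twisted_gcd_sum_via_filtration
    (p m s k : ℕ) (hp : p.Prime) (hm : 0 < m) (hs : 0 < s) [NeZero (p ^ m)]
    (χ : Fin s → DirichletCharacter ℂ (p ^ m)) (hk : k ≤ m)
    (U : ℕ → Finset (ZMod (p ^ m))ˣ)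
    (hU0 : U 0 = Finset.univ)
    (hUj : ∀ j, 1 ≤ j → U j = Finset.univ.filter fun x : (ZMod (p ^ m))ˣ =>
      ∃ y : ZMod (p ^ m), (x : ZMod (p ^ m)) = 1 + (p : ZMod (p ^ m)) ^ j * y) :
    ∑ a ∈ Fintype.piFinset
        (fun _ : Fin s => (Finset.Icc 1 (p ^ m)).filter fun x => Nat.Coprime x p),
      (Nat.gcd (Finset.univ.gcd fun i => a i - 1) (p ^ k) : ℂ) * ∏ i, χ i (a i)
    = (∑ a ∈ Fintype.piFinset (fun _ : Fin s => U 0),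
          ∏ i, χ i ((a i : ZMod (p ^ m)))) +
      ∑ j ∈ Finset.Icc 1 k, ((p ^ j - p ^ (j - 1) : ℕ) : ℂ) *
        ∑ a ∈ Fintype.piFinset (fun _ : Fin s => U j),
          ∏ i, χ i ((a i : ZMod (p ^ m))) := by
  have hV : ∀ j, ∀ u : (ZMod (p ^ m))ˣ, u ∈ U j ↔
      ∃ y : ZMod (p ^ m), (u : ZMod (p ^ m)) = 1 + (p : ZMod (p ^ m)) ^ j * y := by
    intro j u
    rcases Nat.eq_zero_or_pos j with rfl | h
    · rw [hU0]
      simp only [Finset.mem_univ, pow_zero, one_mul, true_iff]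
      exact ⟨u - 1, by ring⟩
    · rw [hUj j h]; simp
  have key : ∀ j ≤ m, ∑ a ∈ Fintype.piFinset (fun _ : Fin s => U j),
        ∏ i, χ i ((a i : ZMod (p ^ m))) =
      ∑ a ∈ Fintype.piFinset
        (fun _ : Fin s => (Finset.Icc 1 (p ^ m)).filter fun x => Nat.Coprime x p),
        if p ^ j ∣ Finset.univ.gcd fun i => a i - 1 then
          ∏ i, χ i (a i : ZMod (p ^ m)) else 0 := by
    intro j hj
    rw [← Finset.sum_filter]
    have hset : (Fintype.piFinset
        (fun _ : Fin s => (Finset.Icc 1 (p ^ m)).filter fun x => Nat.Coprime x p)).filter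
          (fun a => p ^ j ∣ Finset.univ.gcd fun i => a i - 1) =
        Fintype.piFinset (fun _ : Fin s =>
          ((Finset.Icc 1 (p ^ m)).filter fun x => Nat.Coprime x p).filter
            (fun x => p ^ j ∣ x - 1)) := by
      ext a
      simp only [Finset.mem_filter, Fintype.mem_piFinset, Finset.dvd_gcd_iff, Finset.mem_univ,
        true_imp_iff, forall_and]
    rw [hset, ← Finset.prod_univ_sum (fun _ : Fin s => U j)
      (fun i u => χ i (u : ZMod (p ^ m))), ← Finset.prod_univ_sum (fun _ : Fin s =>
          ((Finset.Icc 1 (p ^ m)).filter fun x => Nat.Coprime x p).filter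
            (fun x => p ^ j ∣ x - 1)) (fun i x => χ i (x : ZMod (p ^ m)))]
    exact Finset.prod_congr rfl fun i _ => (sum_one_var p m j hp hm hj (χ i) (U j) (hV j)).symm
  rw [key 0 (Nat.zero_le _), Finset.sum_congr rfl (fun j hj => by
    rw [key j ((Finset.mem_Icc.1 hj).2.trans hk)] :
    ∀ j ∈ Finset.Icc 1 k, ((p ^ j - p ^ (j - 1) : ℕ) : ℂ) *
        ∑ a ∈ Fintype.piFinset (fun _ : Fin s => U j),
          ∏ i, χ i ((a i : ZMod (p ^ m))) = _)]
  simp only [Finset.mul_sum]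
  rw [Finset.sum_comm, ← Finset.sum_add_distrib]
  refine Finset.sum_congr rfl fun a _ => ?_
  rw [gcd_pow_telescope p hp]
  rw [Nat.cast_add, Nat.cast_sum, add_mul, Finset.sum_mul]
  congr 1
  · simp
  · refine Finset.sum_congr rfl fun j _ => ?_
    split_ifs <;> simp
end

section
/- Let n = p^m be a prime power, s > 1 and r ≥ 0 integers, and 0 ≤ u ≤ m. Then ∑_{k=u}^{m} (1 − p^{(1−s)(k−u+1)}) · #{(b₁,…,b_r) ∈ [1,p^m]^r : gcd(b₁,…,b_r,p^m) = p^k} = (1 − p^{1−s})·p^{(m−u)r}·∑_{k=0}^{m−u} p^{(1−s−r)k}. -/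
open Finset

lemma tuple_count_aux (p m r u : ℕ) (hp : p.Prime) (hu : u ≤ m) :
    ∑ k ∈ Finset.Icc u m,
        ((Fintype.piFinset (fun _ : Fin r => Finset.Icc 1 (p ^ m))).filter
            (fun b => Nat.gcd (Finset.univ.gcd fun j => b j) (p ^ m) = p ^ k)).card
    = p ^ ((m - u) * r) := by
  rw [← Finset.card_biUnion]
  · have h : ((Finset.Icc u m).biUnion fun k =>
        (Fintype.piFinset (fun _ : Fin r => Finset.Icc 1 (p ^ m))).filter
            (fun b => Nat.gcd (Finset.univ.gcd fun j => b j) (p ^ m) = p ^ k))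
        = Fintype.piFinset (fun _ : Fin r => (Finset.Ioc 0 (p ^ m)).filter (fun x => p ^ u ∣ x)) := by
      ext b
      simp only [Finset.mem_biUnion, Finset.mem_filter, Fintype.mem_piFinset, Finset.mem_Icc,
        Finset.mem_Ioc]
      constructor
      · rintro ⟨k, ⟨hk, hkm⟩, hb, hg⟩ j
        refine ⟨⟨(hb j).1, (hb j).2⟩, ?_⟩
        have h1 : p ^ k ∣ Finset.univ.gcd fun j => b j := hg ▸ Nat.gcd_dvd_left _ _
        exact (pow_dvd_pow p hk).trans (h1.trans (Finset.gcd_dvd (Finset.mem_univ j)))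
      · intro hb
        obtain ⟨k, hk, hg⟩ := (Nat.dvd_prime_pow hp).1
          (Nat.gcd_dvd_right (Finset.univ.gcd fun j => b j) (p ^ m))
        refine ⟨k, ⟨?_, hk⟩, fun j => ⟨(hb j).1.1, (hb j).1.2⟩, hg⟩
        rw [← Nat.pow_dvd_pow_iff_le_right hp.one_lt, ← hg]
        exact Nat.dvd_gcd (Finset.dvd_gcd fun j _ => (hb j).2) (pow_dvd_pow p hu)
    rw [h, Fintype.card_piFinset]
    simp only [Nat.Ioc_filter_dvd_card_eq_div, Finset.prod_const, Finset.card_univ,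
      Fintype.card_fin]
    rw [Nat.pow_div hu hp.pos, pow_mul]
  · intro i _ j _ hij
    refine Finset.disjoint_filter.2 fun b _ h1 h2 => hij ?_
    exact Nat.pow_right_injective hp.two_le (h1.symm.trans h2)

lemma weighted_sum_aux (q x : ℚ) (hx : x ≠ 0) (m : ℕ) (c : ℕ → ℚ)
    (hc : ∀ u ≤ m, ∑ k ∈ Finset.Icc u m, c k = x ^ (m - u)) (d : ℕ) :
    ∀ u, u + d = m → ∑ k ∈ Finset.Icc u m, (1 - q ^ (k - u + 1)) * c k
      = (1 - q) * x ^ d * ∑ k ∈ Finset.range (d + 1), (q / x) ^ k := by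
  induction d with
  | zero =>
    intro u hu
    obtain rfl : u = m := by omega
    have := hc u le_rfl
    simp at this
    simp [this]
  | succ d ih =>
    intro u hu
    have h1 := ih (u + 1) (by omega)
    have h2 := hc u (by omega)
    have e : ∑ k ∈ Finset.Icc u m, (1 - q ^ (k - u + 1)) * c k
        = (1 - q) * ∑ k ∈ Finset.Icc u m, c k
          + q * ∑ k ∈ Finset.Icc (u + 1) m, (1 - q ^ (k - (u + 1) + 1)) * c k := by
      have e1 : ∑ k ∈ Finset.Icc (u + 1) m, (1 - q ^ (k - (u + 1) + 1)) * c k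
          = ∑ k ∈ Finset.Icc u m, (1 - q ^ (k - u)) * c k := by
        rw [← Finset.add_sum_Ioc_eq_sum_Icc (a := u) (b := m) (by omega)]
        simp only [Nat.sub_self, pow_zero, sub_self, zero_mul, zero_add]
        refine Finset.sum_congr (by ext; simp) fun k hk => ?_
        rw [Finset.mem_Ioc] at hk
        rw [show k - (u + 1) + 1 = k - u by omega]
      rw [e1, Finset.mul_sum, Finset.mul_sum, ← Finset.sum_add_distrib]
      exact Finset.sum_congr rfl fun k _ => by ring
    rw [e, h1, h2, Finset.sum_range_succ' _ (d + 1), show m - u = d + 1 by omega]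
    simp only [pow_succ _ _, ← Finset.sum_mul]
    field_simp
    ring

/-- the rational identity for the weighted count of `r`-tuples
with prescribed gcd with `p^m`, where `p^{(1-s)j}` means `1 / p^{(s-1)j}`. -/
theorem weighted_tuple_count_identity
    (p m r s u : ℕ) (hp : p.Prime) (hm : 0 < m) (hs : 1 < s) (hu : u ≤ m) :
    ∑ k ∈ Finset.Icc u m,
      (1 - (p : ℚ) ^ ((1 - (s : ℤ)) * ((k : ℤ) - (u : ℤ) + 1))) *
        (((Fintype.piFinset (fun _ : Fin r => Finset.Icc 1 (p ^ m))).filter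
            (fun b => Nat.gcd (Finset.univ.gcd fun j => b j) (p ^ m) = p ^ k)).card : ℚ)
    = (1 - (p : ℚ) ^ (1 - (s : ℤ))) * (p : ℚ) ^ ((m - u) * r) *
        ∑ k ∈ Finset.range (m - u + 1), (p : ℚ) ^ ((1 - (s : ℤ) - (r : ℤ)) * (k : ℤ)) := by
  have hp0 : (p : ℚ) ≠ 0 := by exact_mod_cast hp.ne_zero
  have h := weighted_sum_aux ((p : ℚ) ^ (1 - (s : ℤ))) ((p : ℚ) ^ r) (pow_ne_zero _ hp0) m
    (fun k => (((Fintype.piFinset (fun _ : Fin r => Finset.Icc 1 (p ^ m))).filter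
            (fun b => Nat.gcd (Finset.univ.gcd fun j => b j) (p ^ m) = p ^ k)).card : ℚ))
    (fun v hv => by
      have := tuple_count_aux p m r v hp hv
      rw [← pow_mul, mul_comm r]
      exact_mod_cast this) (m - u) u (by omega)
  rw [← pow_mul, mul_comm r] at h
  convert h using 1
  · refine Finset.sum_congr rfl fun k hk => ?_
    rw [Finset.mem_Icc] at hk
    rw [zpow_mul, show (k : ℤ) - u + 1 = ((k - u + 1 : ℕ) : ℤ) by omega, zpow_natCast]
  · congr 1
    refine Finset.sum_congr rfl fun k _ => ?_
    rw [zpow_mul, zpow_natCast, zpow_sub₀ hp0 _ (r : ℤ), zpow_natCast]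
end

section
/- Let n = p^m be a prime power and r ≥ 0, s > 0 integers. Then ∑_{k=0}^{m} φ(p^m)·p^{(m−k)(s−1)}·σ_{s−1}(p^k) · #{(b₁,…,b_r) ∈ [1,p^m]^r : gcd(b₁,…,b_r,p^m) = p^k} = φ(p^m)·σ_{s+r−1}(p^m). -/
open Finset

lemma tuple_count_dvd (p m r j : ℕ) (hp : p.Prime) (hj : j ≤ m) :
    ((Fintype.piFinset (fun _ : Fin r => Finset.Icc 1 (p ^ m))).filter
      (fun b => p ^ j ∣ Nat.gcd (Finset.univ.gcd fun i => b i) (p ^ m))).card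
      = p ^ ((m - j) * r) := by
  have h1 : ((Fintype.piFinset (fun _ : Fin r => Finset.Icc 1 (p ^ m))).filter
      (fun b => p ^ j ∣ Nat.gcd (Finset.univ.gcd fun i => b i) (p ^ m)))
      = Fintype.piFinset (fun _ : Fin r => (Finset.Icc 1 (p ^ m)).filter (p ^ j ∣ ·)) := by
    ext b
    have hd : p ^ j ∣ p ^ m := pow_dvd_pow p hj
    simp only [mem_filter, Fintype.mem_piFinset, Nat.dvd_gcd_iff, Finset.dvd_gcd_iff, hd,
      Finset.mem_univ, forall_true_left, and_true, forall_and]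
  have h2 : ((Finset.Icc 1 (p ^ m)).filter (p ^ j ∣ ·)).card = p ^ (m - j) := by
    have h := Nat.Ioc_filter_dvd_card_eq_div (p ^ m) (p ^ j)
    rw [Nat.pow_div hj hp.pos] at h
    exact h
  rw [h1, Fintype.card_piFinset]
  simp [h2, pow_mul]

lemma tuple_count_sum (p m r j : ℕ) (hp : p.Prime) :
    ∑ k ∈ (Finset.range (m + 1)).filter (j ≤ ·),
      ((Fintype.piFinset (fun _ : Fin r => Finset.Icc 1 (p ^ m))).filter
        (fun b => Nat.gcd (Finset.univ.gcd fun i => b i) (p ^ m) = p ^ k)).card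
      = ((Fintype.piFinset (fun _ : Fin r => Finset.Icc 1 (p ^ m))).filter
      (fun b => p ^ j ∣ Nat.gcd (Finset.univ.gcd fun i => b i) (p ^ m))).card := by
  rw [← Finset.card_biUnion]
  · congr 1
    ext b
    simp only [mem_biUnion, mem_filter, mem_range]
    constructor
    · rintro ⟨k, ⟨_, hk⟩, hb, he⟩
      exact ⟨hb, he ▸ pow_dvd_pow p hk⟩
    · rintro ⟨hb, hd⟩
      obtain ⟨k, hk, he⟩ := (Nat.dvd_prime_pow hp).1
        (Nat.gcd_dvd_right (Finset.univ.gcd fun i => b i) (p ^ m))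
      rw [he] at hd
      exact ⟨k, ⟨by omega, (Nat.pow_dvd_pow_iff_le_right hp.one_lt).1 hd⟩, hb, he⟩
  · intro a _ c _ hac
    simp only [Function.onFun]
    rw [Finset.disjoint_left]
    intro b hb hb'
    rw [mem_filter] at hb hb'
    exact hac (Nat.pow_right_injective hp.two_le (hb.2.symm.trans hb'.2))

lemma sigma_rewrite (p m k t : ℕ) (hp : p.Prime) (hk : k ≤ m) :
    p ^ ((m - k) * t) * (∑ e ∈ (p ^ k).divisors, e ^ t)
      = ∑ j ∈ Finset.range (k + 1), p ^ ((m - j) * t) := by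
  rw [Nat.sum_divisors_prime_pow hp, Finset.mul_sum, ← Finset.sum_range_reflect]
  refine Finset.sum_congr rfl fun j hj => ?_
  rw [mem_range] at hj
  rw [← pow_mul, ← pow_add, ← add_mul]
  congr 2
  omega

/-- summing `φ(p^m) p^{(m-k)(s-1)} σ_{s-1}(p^k)` against the number
of `r`-tuples with gcd exactly `p^k` gives `φ(p^m) σ_{s+r-1}(p^m)`. -/
theorem weighted_sigma_sum_identity
    (p m r s : ℕ) (hp : p.Prime) (hm : 0 < m) (hs : 0 < s) :
    ∑ k ∈ Finset.range (m + 1),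
      (Nat.totient (p ^ m)) * p ^ ((m - k) * (s - 1)) *
        (∑ e ∈ (p ^ k).divisors, e ^ (s - 1)) *
        ((Fintype.piFinset (fun _ : Fin r => Finset.Icc 1 (p ^ m))).filter
            (fun b => Nat.gcd (Finset.univ.gcd fun j => b j) (p ^ m) = p ^ k)).card
    = Nat.totient (p ^ m) * ∑ e ∈ (p ^ m).divisors, e ^ (s + r - 1) := by
  obtain ⟨t, rfl⟩ : ∃ t, s = t + 1 := ⟨s - 1, by omega⟩
  have e1 : t + 1 + r - 1 = t + r := by omega
  have hR := sigma_rewrite p m m (t + r) hp le_rfl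
  rw [Nat.sub_self, zero_mul, pow_zero, one_mul] at hR
  rw [e1, hR, Nat.add_sub_cancel]
  simp only [mul_assoc]
  rw [← Finset.mul_sum]
  congr 1
  have hL : ∀ k ∈ Finset.range (m + 1), p ^ ((m - k) * t) *
        ((∑ e ∈ (p ^ k).divisors, e ^ t) *
        ((Fintype.piFinset (fun _ : Fin r => Finset.Icc 1 (p ^ m))).filter
            (fun b => Nat.gcd (Finset.univ.gcd fun j => b j) (p ^ m) = p ^ k)).card)
      = ∑ j ∈ Finset.range (k + 1), p ^ ((m - j) * t) *
        ((Fintype.piFinset (fun _ : Fin r => Finset.Icc 1 (p ^ m))).filter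
            (fun b => Nat.gcd (Finset.univ.gcd fun j => b j) (p ^ m) = p ^ k)).card := by
    intro k hk
    rw [mem_range] at hk
    rw [← mul_assoc, sigma_rewrite p m k t hp (by omega), Finset.sum_mul]
  rw [Finset.sum_congr rfl hL]
  rw [Finset.sum_comm' (t' := Finset.range (m + 1))
    (s' := fun j => (Finset.range (m + 1)).filter (j ≤ ·))
    (by intro x y; simp only [mem_range, mem_filter]; omega)]
  refine Finset.sum_congr rfl fun j hj => ?_
  rw [mem_range] at hj
  rw [← Finset.mul_sum, tuple_count_sum p m r j hp, tuple_count_dvd p m r j hp (by omega),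
    ← pow_add, ← mul_add]
end

section
/- Let n be a positive integer. Then ∑_{a ∈ [1,n], gcd(a,n)=1} gcd(a−1, n) = φ(n)·σ₀(n), where σ₀(n) is the number of positive divisors of n (Menon's identity). -/
open Finset

lemma menon_count (n d : ℕ) (hn : 0 < n) (hd : d ∣ n) :
    (((Finset.Icc 1 n).filter (fun a => Nat.Coprime a n)).filter (fun a => d ∣ a - 1)).card
      = Nat.card (ZMod.unitsMap hd).ker := by
  classical
  have : NeZero n := ⟨hn.ne'⟩
  refine Eq.trans ?_ (Nat.card_eq_card_toFinset ((ZMod.unitsMap hd).ker : Set (ZMod n)ˣ)).symm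
  have key : ∀ u : (ZMod n)ˣ, ∀ a : ℕ, 1 ≤ a → (u : ZMod n) = a →
      (u ∈ (ZMod.unitsMap hd).ker ↔ d ∣ a - 1) := by
    intro u a ha hu
    rw [MonoidHom.mem_ker, Units.ext_iff, ZMod.unitsMap_val, hu, ZMod.cast_natCast hd,
      Units.val_one, ← Nat.cast_one, eq_comm, ZMod.natCast_eq_natCast_iff,
      Nat.modEq_iff_dvd' ha]
  refine Finset.card_bij
    (fun a ha => ZMod.unitOfCoprime a (by simp only [Finset.mem_filter] at ha; exact ha.1.2))
    ?_ ?_ ?_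
  · intro a ha
    simp only [Finset.mem_filter, Finset.mem_Icc] at ha
    simp only [Set.mem_toFinset, SetLike.mem_coe]
    exact (key _ a ha.1.1.1 (ZMod.coe_unitOfCoprime _ _)).2 ha.2
  · intro a ha b hb h
    simp only [Finset.mem_filter, Finset.mem_Icc] at ha hb
    rw [Units.ext_iff, ZMod.coe_unitOfCoprime, ZMod.coe_unitOfCoprime,
      ZMod.natCast_eq_natCast_iff] at h
    obtain ⟨a, rfl⟩ := Nat.exists_eq_add_of_le' ha.1.1.1
    obtain ⟨b, rfl⟩ := Nat.exists_eq_add_of_le' hb.1.1.1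
    rw [Nat.ModEq.add_right_cancel (Nat.ModEq.refl 1) h |>.eq_of_lt_of_lt (by omega) (by omega)]
  · intro u hu
    simp only [Set.mem_toFinset, SetLike.mem_coe] at hu
    have hc : (u : ZMod n) = ((((u : ZMod n) - 1).val + 1 : ℕ) : ZMod n) := by
      push_cast
      rw [ZMod.natCast_zmod_val]; ring
    have hlt := ZMod.val_lt ((u : ZMod n) - 1)
    have hcop : Nat.Coprime (((u : ZMod n) - 1).val + 1) n := by
      rw [← ZMod.isUnit_iff_coprime, ← hc]; exact u.isUnit
    refine ⟨((u : ZMod n) - 1).val + 1, ?_, ?_⟩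
    · simp only [Finset.mem_filter, Finset.mem_Icc]
      exact ⟨⟨⟨by omega, by omega⟩, hcop⟩, (key u _ (by omega) hc).1 hu⟩
    · rw [Units.ext_iff, ZMod.coe_unitOfCoprime]; exact hc.symm

lemma menon_ker (n d : ℕ) (hn : 0 < n) (hd : d ∣ n) :
    Nat.totient d * Nat.card (ZMod.unitsMap hd).ker = Nat.totient n := by
  have : NeZero n := ⟨hn.ne'⟩
  have : NeZero d := ⟨(Nat.pos_of_dvd_of_pos hd hn).ne'⟩
  have h := (ZMod.unitsMap hd).ker.card_mul_index
  rw [Subgroup.index_ker, MonoidHom.range_eq_top.2 (ZMod.unitsMap_surjective hd),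
    Subgroup.card_top, Nat.card_eq_fintype_card (α := (ZMod n)ˣ),
    Nat.card_eq_fintype_card (α := (ZMod d)ˣ), ZMod.card_units_eq_totient,
    ZMod.card_units_eq_totient] at h
  rw [mul_comm]; exact h

/-- Menon's identity. -/
theorem menon_identity (n : ℕ) (hn : 0 < n) :
    ∑ a ∈ (Finset.Icc 1 n).filter (fun a => Nat.Coprime a n), Nat.gcd (a - 1) n
    = Nat.totient n * n.divisors.card := by
  have h1 : ∀ a, Nat.gcd (a - 1) n
      = ∑ d ∈ n.divisors, if d ∣ a - 1 then Nat.totient d else 0 := by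
    intro a
    rw [← Finset.sum_filter]
    conv_lhs => rw [← Nat.sum_totient (Nat.gcd (a - 1) n)]
    refine Finset.sum_congr ?_ fun _ _ => rfl
    ext d
    simp only [Nat.mem_divisors, Finset.mem_filter, Nat.dvd_gcd_iff]
    have : Nat.gcd (a - 1) n ≠ 0 := (Nat.gcd_pos_of_pos_right _ hn).ne'
    have := hn.ne'
    tauto
  simp_rw [h1]
  rw [Finset.sum_comm, mul_comm, ← smul_eq_mul, ← Finset.sum_const]
  refine Finset.sum_congr rfl fun d hd => ?_
  have hd' := Nat.dvd_of_mem_divisors hd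
  rw [← Finset.sum_filter, Finset.sum_const, smul_eq_mul, menon_count n d hn hd', mul_comm,
    menon_ker n d hn hd']
end

section
/- Let n be a positive integer and r ≥ 0 an integer. Then ∑ gcd(a−1, b₁, …, b_r, n), where a ranges over integers in [1,n] coprime to n and b₁, …, b_r range over integers in [1,n], equals φ(n)·σ_r(n) (Sury's identity). -/
open Finset

lemma sury_count_units (n d : ℕ) (hn : 0 < n) (hd : d ∣ n) :
    Nat.totient d * #{a ∈ (Finset.Icc 1 n).filter (fun a => Nat.Coprime a n) | d ∣ a - 1}
      = Nat.totient n := by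
  have : NeZero n := ⟨hn.ne'⟩
  have : NeZero d := ⟨(Nat.pos_of_dvd_of_pos hd hn).ne'⟩
  have hker : Nat.card (ZMod.unitsMap hd).ker * Nat.totient d = Nat.totient n := by
    have h := Subgroup.card_mul_index (ZMod.unitsMap hd).ker
    rw [Subgroup.index_ker, MonoidHom.range_eq_top.mpr (ZMod.unitsMap_surjective hd),
      Subgroup.card_top, Nat.card_eq_fintype_card (α := (ZMod d)ˣ),
      Nat.card_eq_fintype_card (α := (ZMod n)ˣ), ZMod.card_units_eq_totient,
      ZMod.card_units_eq_totient] at h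
    exact h
  rw [← hker, mul_comm]
  congr 1
  have h1 : Nat.card (ZMod.unitsMap hd).ker
      = #{u : (ZMod n)ˣ | ZMod.unitsMap hd u = 1} := by
    rw [Nat.card_eq_fintype_card, Fintype.card_subtype]
    simp only [MonoidHom.mem_ker]
  rw [h1]
  have key : ∀ a : ℕ, 1 ≤ a → ((a : ZMod d) = 1 ↔ d ∣ a - 1) := by
    intro a ha
    rw [← ZMod.natCast_eq_zero_iff, Nat.cast_sub ha, sub_eq_zero, Nat.cast_one]
  refine Finset.card_bij (fun a ha => ZMod.unitOfCoprime a (by simp at ha; exact ha.1.2)) ?_ ?_ ?_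
  · intro a ha
    simp only [mem_filter, mem_Icc] at ha
    simp only [mem_filter, mem_univ, true_and]
    ext
    simp [ZMod.unitsMap_val, ZMod.cast_natCast hd, (key a ha.1.1.1).mpr ha.2]
  · intro a ha b hb hab
    simp only [mem_filter, mem_Icc] at ha hb
    have h2 := congrArg Units.val hab
    simp only [ZMod.coe_unitOfCoprime, ZMod.natCast_eq_natCast_iff] at h2
    obtain ⟨⟨⟨ha1, ha2⟩, -⟩, -⟩ := ha
    obtain ⟨⟨⟨hb1, hb2⟩, -⟩, -⟩ := hb
    have h3 : (n : ℤ) ∣ (b : ℤ) - a := (Nat.modEq_iff_dvd).mp h2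
    have h4 := Int.eq_zero_of_abs_lt_dvd h3 (by rw [abs_lt]; constructor <;> omega)
    omega
  · intro u hu
    simp only [mem_filter, mem_univ, true_and] at hu
    obtain ⟨a, ha1, ha2, ha⟩ : ∃ a : ℕ, 1 ≤ a ∧ a ≤ n ∧ (a : ZMod n) = u := by
      by_cases h0 : (u : ZMod n).val = 0
      · exact ⟨n, hn, le_rfl, by simpa using ((ZMod.val_eq_zero _).mp h0).symm⟩
      · exact ⟨(u : ZMod n).val, by omega, (ZMod.val_lt _).le, by simp⟩
    have hc : Nat.Coprime a n := (ZMod.isUnit_iff_coprime a n).mp (ha ▸ u.isUnit)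
    refine ⟨a, ?_, ?_⟩
    · simp only [mem_filter, mem_Icc]
      refine ⟨⟨⟨ha1, ha2⟩, hc⟩, (key a ha1).mp ?_⟩
      have h5 := congrArg Units.val hu
      rw [ZMod.unitsMap_val, ← ha] at h5
      simpa [ZMod.cast_natCast hd] using h5
    · ext; simp [ha]

lemma sury_count_pi (n d r : ℕ) :
    #{b ∈ Fintype.piFinset (fun _ : Fin r => Finset.Icc 1 n) | ∀ j, d ∣ b j} = (n / d) ^ r := by
  have : {b ∈ Fintype.piFinset (fun _ : Fin r => Finset.Icc 1 n) | ∀ j, d ∣ b j}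
      = Fintype.piFinset (fun _ : Fin r => {x ∈ Finset.Ioc 0 n | d ∣ x}) := by
    ext b
    simp only [mem_filter, Fintype.mem_piFinset, mem_Icc, mem_Ioc, Nat.succ_le_iff, forall_and]
  rw [this, Fintype.card_piFinset]
  simp [Nat.Ioc_filter_dvd_card_eq_div]

/-- Sury's identity. -/
theorem sury_identity (n r : ℕ) (hn : 0 < n) :
    ∑ a ∈ (Finset.Icc 1 n).filter (fun a => Nat.Coprime a n),
      ∑ b ∈ Fintype.piFinset (fun _ : Fin r => Finset.Icc 1 n),
        Nat.gcd (a - 1) (Nat.gcd (Finset.univ.gcd fun j => b j) n)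
    = Nat.totient n * ∑ e ∈ n.divisors, e ^ r := by
  have hg : ∀ (a : ℕ) (b : Fin r → ℕ),
      Nat.gcd (a - 1) (Nat.gcd (Finset.univ.gcd fun j => b j) n)
      = ∑ d ∈ n.divisors, Nat.totient d * ((if d ∣ a - 1 then 1 else 0) *
          (if ∀ j, d ∣ b j then 1 else 0)) := by
    intro a b
    rw [← Nat.sum_totient (Nat.gcd (a - 1) _)]
    have : (Nat.gcd (a - 1) (Nat.gcd (Finset.univ.gcd fun j => b j) n)).divisors
        = {d ∈ n.divisors | d ∣ a - 1 ∧ ∀ j, d ∣ b j} := by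
      ext d
      simp only [Nat.mem_divisors, mem_filter, Nat.dvd_gcd_iff, Finset.dvd_gcd_iff, mem_univ,
        true_imp_iff, Ne, Nat.gcd_eq_zero_iff, hn.ne', and_false, not_false_iff, and_true]
      tauto
    rw [this, sum_filter]
    refine sum_congr rfl fun d _ => ?_
    by_cases h1 : d ∣ a - 1 <;> by_cases h2 : ∀ j, d ∣ b j <;> simp [h1, h2]
  simp only [hg]
  simp_rw [Finset.sum_comm (t := n.divisors)]
  rw [← Nat.sum_div_divisors n (fun e => e ^ r), mul_sum]
  refine sum_congr rfl fun d hd => ?_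
  simp_rw [← mul_sum, ← sum_mul, ← card_filter]
  rw [sury_count_pi, ← mul_assoc, sury_count_units n d hn (Nat.dvd_of_mem_divisors hd)]
end

section
/- Let n = p₁^{m₁}⋯p_w^{m_w} be the prime factorization of a positive integer n, and let r ≥ 0, s > 0 be integers. Then ∑ gcd(a₁−1, …, a_s−1, b₁, …, b_r, n), where a₁, …, a_s range over integers in [1,n] coprime to n and b₁, …, b_r range over integers in [1,n], equals φ(n)·∏_{i=1}^{w} (φ(p_i^{m_i})^{s−1}·p_i^{m_i r} − p_i^{m_i(s+r−1)} + σ_{s+r−1}(p_i^{m_i})) (Li–Kim's identity). -/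
open Finset

lemma lk_units_count (n d : ℕ) (hn : 0 < n) (hd : d ∣ n) :
    (#{x ∈ (Finset.Icc 1 n).filter (fun x => Nat.Coprime x n) | d ∣ x - 1}) * d.totient
      = n.totient := by
  classical
  have : NeZero n := ⟨hn.ne'⟩
  have : NeZero d := ⟨(Nat.pos_of_dvd_of_pos hd hn).ne'⟩
  have hk : Nat.card (ZMod.unitsMap hd).ker * d.totient = n.totient := by
    have h1 := Subgroup.card_mul_index (ZMod.unitsMap hd).ker
    rw [Subgroup.index_ker, MonoidHom.range_eq_top.mpr (ZMod.unitsMap_surjective hd)] at h1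
    simpa [Nat.card_eq_fintype_card, ZMod.card_units_eq_totient] using h1
  rw [← hk]
  congr 1
  have : Nat.card (ZMod.unitsMap hd).ker
      = #(Finset.univ.filter (fun u : (ZMod n)ˣ => ZMod.unitsMap hd u = 1)) := by
    rw [← Nat.subtype_card (p := fun u => u ∈ (ZMod.unitsMap hd).ker)]
    · intro x; simp [MonoidHom.mem_ker]
  rw [this]
  refine Finset.card_bij (fun x hx => ZMod.unitOfCoprime x
    (by simp only [mem_filter] at hx; exact hx.1.2)) ?_ ?_ ?_
  · intro x hx
    simp only [mem_filter, mem_Icc] at hx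
    simp only [mem_filter, mem_univ, true_and]
    ext
    rw [ZMod.unitsMap_val]
    simp only [ZMod.coe_unitOfCoprime, Units.val_one]
    rw [ZMod.cast_natCast hd]
    have := (ZMod.natCast_eq_zero_iff (x-1) d).2 hx.2
    rw [Nat.cast_sub hx.1.1.1] at this
    simpa using sub_eq_zero.1 this
  · intro x hx y hy h
    simp only [mem_filter, mem_Icc] at hx hy
    have h2 := congrArg (fun u : (ZMod n)ˣ => (u : ZMod n)) h
    simp only [ZMod.coe_unitOfCoprime] at h2
    have h3 := (ZMod.natCast_eq_natCast_iff x y n).1 h2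
    have h4 : (x-1) ≡ (y-1) [MOD n] := by
      apply Nat.ModEq.add_right_cancel' 1
      rwa [Nat.sub_add_cancel hx.1.1.1, Nat.sub_add_cancel hy.1.1.1]
    have := Nat.ModEq.eq_of_lt_of_lt h4 (by omega) (by omega)
    omega
  · intro u hu
    simp only [mem_filter, mem_univ, true_and] at hu
    obtain ⟨x, hx1, hxn, hx⟩ : ∃ x : ℕ, 1 ≤ x ∧ x ≤ n ∧ (x : ZMod n) = u := by
      by_cases h0 : (u : ZMod n).val = 0
      · exact ⟨n, hn, le_rfl, by simp [(ZMod.val_eq_zero _).1 h0]⟩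
      · exact ⟨(u : ZMod n).val, Nat.pos_of_ne_zero h0, (ZMod.val_lt _).le, by simp⟩
    have hc : Nat.Coprime x n := (ZMod.isUnit_iff_coprime x n).1 (hx ▸ u.isUnit)
    refine ⟨x, ?_, ?_⟩
    · simp only [mem_filter, mem_Icc]
      refine ⟨⟨⟨hx1, hxn⟩, hc⟩, ?_⟩
      rw [← ZMod.natCast_eq_zero_iff, Nat.cast_sub hx1]
      have := congrArg (fun u : (ZMod d)ˣ => (u : ZMod d)) hu
      simp only [ZMod.unitsMap_val, ← hx, ZMod.cast_natCast hd] at this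
      simp [this]
    · ext; simp [hx]

lemma lk_gcd (n r s : ℕ) (hn : 0 < n) (a : Fin s → ℕ) (b : Fin r → ℕ) :
    ((Nat.gcd (Finset.univ.gcd fun i => a i - 1)
            (Nat.gcd (Finset.univ.gcd fun j => b j) n) : ℕ) : ℤ)
    = ∑ d ∈ n.divisors, (d.totient : ℤ) *
       ((∏ i, if d ∣ a i - 1 then 1 else 0) * ∏ j, if d ∣ b j then 1 else 0) := by
  set g := Nat.gcd (Finset.univ.gcd fun i => a i - 1)
            (Nat.gcd (Finset.univ.gcd fun j => b j) n) with hg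
  have hgn : g ∣ n := (Nat.gcd_dvd_right _ _).trans (Nat.gcd_dvd_right _ _)
  rw [← Nat.sum_totient g]
  push_cast
  have hdiv : g.divisors = n.divisors.filter (fun d => (∀ i, d ∣ a i - 1) ∧ ∀ j, d ∣ b j) := by
    ext d
    simp only [Nat.mem_divisors, mem_filter, hg, Nat.dvd_gcd_iff, Finset.dvd_gcd_iff, mem_univ,
      true_imp_iff]
    have : g ≠ 0 := fun h => hn.ne' (by simpa [h] using hgn)
    rw [hg] at this
    have hn' := hn.ne'
    constructor
    · rintro ⟨⟨h1, h2, h3⟩, -⟩; exact ⟨⟨h3, hn'⟩, h1, h2⟩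
    · rintro ⟨⟨h3, -⟩, h1, h2⟩; exact ⟨⟨h1, h2, h3⟩, this⟩
  rw [hdiv, Finset.sum_filter]
  refine Finset.sum_congr rfl fun d _ => ?_
  rw [Finset.prod_ite_zero, Finset.prod_ite_zero]
  simp only [mem_univ, true_imp_iff, prod_const_one]
  split_ifs <;> simp_all

lemma lk_sum (n r s : ℕ) (hn : 0 < n) :
    ∑ a ∈ Fintype.piFinset (fun _ : Fin s => (Finset.Icc 1 n).filter fun x => Nat.Coprime x n),
      ∑ b ∈ Fintype.piFinset (fun _ : Fin r => Finset.Icc 1 n),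
        (Nat.gcd (Finset.univ.gcd fun i => a i - 1)
            (Nat.gcd (Finset.univ.gcd fun j => b j) n) : ℤ)
    = ∑ d ∈ n.divisors, (d.totient : ℤ) *
      ((#{x ∈ (Finset.Icc 1 n).filter (fun x => Nat.Coprime x n) | d ∣ x - 1} : ℤ) ^ s
        * ((n / d : ℕ) : ℤ) ^ r) := by
  simp_rw [lk_gcd n r s hn]
  simp_rw [Finset.sum_comm (t := n.divisors)]
  refine Finset.sum_congr rfl fun d _ => ?_
  simp_rw [← Finset.mul_sum, ← Finset.sum_mul]
  congr 1
  congr 1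
  · rw [Finset.sum_prod_piFinset _ (fun _ x => if d ∣ x - 1 then (1:ℤ) else 0)]
    simp
  · rw [Finset.sum_prod_piFinset _ (fun _ x => if d ∣ x then (1:ℤ) else 0)]
    have : #{x ∈ Finset.Icc 1 n | d ∣ x} = n / d := by
      exact Nat.Ioc_filter_dvd_card_eq_div n d
    simp [this]

/-- multiplicative summand -/
def lkh (r s : ℕ) : ArithmeticFunction ℚ :=
  ⟨fun d => ((d.totient : ℚ) ^ (s - 1))⁻¹ * ((d:ℚ) ^ r)⁻¹ * (if d = 0 then 0 else 1), by simp⟩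

lemma lkh_mult (r s : ℕ) : (lkh r s).IsMultiplicative := by
  refine ⟨by simp [lkh], ?_⟩
  intro m n h
  simp only [lkh, ArithmeticFunction.coe_mk, Nat.totient_mul h]
  by_cases hm : m = 0
  · simp [hm]
  by_cases hn : n = 0
  · simp [hn]
  simp [hm, hn, mul_pow]
  ring

lemma lk_prod (n r s : ℕ) (hn : 0 < n) :
    (∑ d ∈ n.divisors, ((n.totient : ℚ) / d.totient) ^ (s-1) * ((n:ℚ) / d) ^ r) =
    ∏ p ∈ n.primeFactors, ∑ d ∈ (p ^ n.factorization p).divisors,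
      (((p ^ n.factorization p).totient : ℚ) / d.totient) ^ (s-1) *
        (((p ^ n.factorization p : ℕ):ℚ) / d) ^ r := by
  have key : ∀ n : ℕ, n ≠ 0 →
      (∑ d ∈ n.divisors, ((n.totient : ℚ) / d.totient) ^ (s-1) * ((n:ℚ) / d) ^ r) =
      (n.totient : ℚ) ^ (s-1) * (n:ℚ) ^ r * ((ArithmeticFunction.zeta : ArithmeticFunction ℚ) * lkh r s) n := by
    intro n hn
    rw [ArithmeticFunction.coe_zeta_mul_apply, Finset.mul_sum]
    refine Finset.sum_congr rfl fun d hd => ?_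
    have : d ≠ 0 := (Nat.pos_of_mem_divisors hd).ne'
    simp [lkh, this, div_pow]
    ring
  have hm : (((ArithmeticFunction.zeta : ArithmeticFunction ℚ) * lkh r s)).IsMultiplicative :=
    ArithmeticFunction.isMultiplicative_zeta.natCast.mul (lkh_mult r s)
  rw [key n hn.ne', Nat.multiplicative_factorization
    (fun n : ℕ => (n.totient : ℚ) ^ (s-1) * (n:ℚ) ^ r * ((ArithmeticFunction.zeta : ArithmeticFunction ℚ) * lkh r s) n) ?_ ?_ hn.ne']
  · rw [Finsupp.prod, Nat.support_factorization]
    refine Finset.prod_congr rfl fun p hp => ?_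
    rw [key _ (pow_ne_zero _ (Nat.prime_of_mem_primeFactors hp).ne_zero)]
  · intro x y h
    simp only [Nat.totient_mul h, hm.map_mul_of_coprime h]
    push_cast
    ring
  · simp [hm.map_one]

lemma lk_local (p m r s : ℕ) (hp : p.Prime) (hm : 0 < m) (hs : 0 < s) :
    ∑ d ∈ (p ^ m).divisors,
      (((p ^ m).totient : ℚ) / d.totient) ^ (s-1) * (((p ^ m : ℕ):ℚ) / d) ^ r
    = ((p ^ m).totient : ℚ) ^ (s - 1) * (p : ℚ) ^ (m * r) - (p : ℚ) ^ (m * (s + r - 1)) +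
            ∑ e ∈ (p ^ m).divisors, (e : ℚ) ^ (s + r - 1) := by
  rw [← Nat.sum_div_divisors (p^m) (fun e => (e : ℚ) ^ (s + r - 1))]
  have h1 : 1 ∈ (p^m).divisors := by simp [hp.ne_zero]
  rw [← Finset.add_sum_erase _ _ h1, ← Finset.add_sum_erase _ _ h1]
  have : ∀ d ∈ (p^m).divisors.erase 1,
      (((p ^ m).totient : ℚ) / d.totient) ^ (s-1) * (((p ^ m : ℕ):ℚ) / d) ^ r
      = ((p^m / d : ℕ) : ℚ) ^ (s + r - 1) := by
    intro d hd
    rw [mem_erase, Nat.mem_divisors_prime_pow hp] at hd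
    obtain ⟨hd1, k, hk, rfl⟩ := hd
    have hk0 : 0 < k := Nat.pos_of_ne_zero (by rintro rfl; simp at hd1)
    have hp0 : (p:ℚ) ≠ 0 := by exact_mod_cast hp.ne_zero
    have hp1 : (p:ℚ) - 1 ≠ 0 := sub_ne_zero.2 (by exact_mod_cast hp.one_lt.ne')
    rw [Nat.cast_div (pow_dvd_pow p hk) (by exact_mod_cast pow_ne_zero k hp0)]
    have e : ((p ^ m).totient : ℚ) / (p^k).totient = ((p^m : ℕ) : ℚ) / (p^k : ℕ) := by
      obtain ⟨k, rfl⟩ := Nat.exists_eq_succ_of_ne_zero hk0.ne'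
      obtain ⟨m, rfl⟩ := Nat.exists_eq_succ_of_ne_zero hm.ne'
      rw [Nat.totient_prime_pow_succ hp, Nat.totient_prime_pow_succ hp]
      push_cast [hp.one_le]
      field_simp
      simp only [Nat.succ_eq_add_one]
      ring
    rw [e, ← pow_add]
    congr 1
    omega
  rw [Finset.sum_congr rfl this]
  simp [← pow_mul]
  ring

/-- Li–Kim's identity. -/
theorem li_kim_identity (n r s : ℕ) (hn : 0 < n) (hs : 0 < s) :
    ∑ a ∈ Fintype.piFinset (fun _ : Fin s => (Finset.Icc 1 n).filter fun x => Nat.Coprime x n),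
      ∑ b ∈ Fintype.piFinset (fun _ : Fin r => Finset.Icc 1 n),
        (Nat.gcd (Finset.univ.gcd fun i => a i - 1)
            (Nat.gcd (Finset.univ.gcd fun j => b j) n) : ℤ)
    = (Nat.totient n : ℤ) *
        ∏ p ∈ n.primeFactors,
          ((Nat.totient (p ^ n.factorization p) : ℤ) ^ (s - 1) *
              (p : ℤ) ^ (n.factorization p * r) -
            (p : ℤ) ^ (n.factorization p * (s + r - 1)) +
            ∑ e ∈ (p ^ n.factorization p).divisors, (e : ℤ) ^ (s + r - 1)) := by
  rw [lk_sum n r s hn]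
  have hR : ∀ p ∈ n.primeFactors, _ := fun p hp =>
    lk_local p (n.factorization p) r s (Nat.prime_of_mem_primeFactors hp)
      ((Nat.prime_of_mem_primeFactors hp).factorization_pos_of_dvd hn.ne'
        (Nat.dvd_of_mem_primeFactors hp)) hs
  have h := lk_prod n r s hn
  rw [Finset.prod_congr rfl hR] at h
  have goalQ := congrArg (fun x : ℚ => (n.totient : ℚ) * x) h
  simp only [Finset.mul_sum (s := n.divisors)] at goalQ
  apply Int.cast_injective (α := ℚ)
  simp only [Int.cast_sum, Int.cast_mul, Int.cast_prod, Int.cast_pow, Int.cast_natCast,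
    Int.cast_sub, Int.cast_add]
  rw [← goalQ]
  refine Finset.sum_congr rfl fun d hd => ?_
  have hdn := Nat.dvd_of_mem_divisors hd
  have hd0 := Nat.pos_of_mem_divisors hd
  have hc := lk_units_count n d hn hdn
  have ht : (d.totient : ℚ) ≠ 0 := by exact_mod_cast (Nat.totient_pos.2 hd0).ne'
  rw [Nat.cast_div hdn (by exact_mod_cast hd0.ne'), ← hc]
  generalize #{x ∈ (Finset.Icc 1 n).filter (fun x => Nat.Coprime x n) | d ∣ x - 1} = A
  obtain ⟨s, rfl⟩ := Nat.exists_eq_succ_of_ne_zero hs.ne'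
  push_cast
  rw [mul_div_cancel_right₀ _ ht]
  simp only [Nat.succ_eq_add_one, Nat.add_sub_cancel]
  ring
end

section
/- Let n be a positive integer and χ a Dirichlet character modulo n with conductor d. Then ∑_{a ∈ [1,n], gcd(a,n)=1} gcd(a−1, n)·χ(a) = φ(n)·σ₀(n/d) (Zhao–Cao's identity). -/
open Finset

lemma zc_sum_units (n : ℕ) [NeZero n] (f : ZMod n → ℂ) :
    ∑ a ∈ (Finset.Icc 1 n).filter (fun a => Nat.Coprime a n), f (a : ZMod n)
      = ∑ u : (ZMod n)ˣ, f u := by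
  have hn : 0 < n := Nat.pos_of_ne_zero (NeZero.ne n)
  refine Finset.sum_bij (fun a ha => ZMod.unitOfCoprime a (Finset.mem_filter.1 ha).2) ?_ ?_ ?_ ?_
  · intro a ha
    exact Finset.mem_univ _
  · intro a ha b hb hab
    have h := congrArg (fun u : (ZMod n)ˣ => (u : ZMod n)) hab
    simp only [ZMod.coe_unitOfCoprime] at h
    rw [ZMod.natCast_eq_natCast_iff] at h
    simp only [Finset.mem_filter, Finset.mem_Icc] at ha hb
    have h2 : (a : ℤ) ≡ b [ZMOD n] := (Int.natCast_modEq_iff).2 h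
    have h3 := h2.dvd
    have h4 : (b : ℤ) - a = 0 := by
      apply Int.eq_zero_of_abs_lt_dvd h3
      rw [abs_lt]
      omega
    omega
  · intro u _
    by_cases h0 : (u : ZMod n).val = 0
    · have hz : (u : ZMod n) = 0 := (ZMod.val_eq_zero _).1 h0
      have hc := ZMod.val_coe_unit_coprime u
      rw [h0, Nat.coprime_zero_left] at hc
      refine ⟨n, ?_, ?_⟩
      · simp only [Finset.mem_filter, Finset.mem_Icc]
        refine ⟨⟨hn, le_rfl⟩, ?_⟩
        rw [hc]
        exact Nat.coprime_one_left 1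
      · apply Units.ext
        simp [hz]
    · refine ⟨(u : ZMod n).val, ?_, ?_⟩
      · simp only [Finset.mem_filter, Finset.mem_Icc]
        exact ⟨⟨Nat.pos_of_ne_zero h0, (ZMod.val_lt _).le⟩, ZMod.val_coe_unit_coprime u⟩
      · apply Units.ext
        simp
  · intro a ha
    simp

lemma zc_inner (n : ℕ) [NeZero n] (χ : DirichletCharacter ℂ n) (m : ℕ) (hm : m ∣ n) :
    (Nat.totient m : ℂ) * ∑ a ∈ (Finset.Icc 1 n).filter (fun a => Nat.Coprime a n),
      (if m ∣ a - 1 then χ (a : ZMod n) else 0)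
      = if χ.conductor ∣ m then (Nat.totient n : ℂ) else 0 := by
  classical
  have hm0 : NeZero m := ⟨fun h => NeZero.ne n (by subst h; exact zero_dvd_iff.1 hm)⟩
  let K := (ZMod.unitsMap hm).ker
  have h1 : ∑ a ∈ (Finset.Icc 1 n).filter (fun a => Nat.Coprime a n),
      (if m ∣ a - 1 then χ (a : ZMod n) else 0) =
      ∑ u : (ZMod n)ˣ, if ZMod.castHom hm (ZMod m) (u : ZMod n) = 1 then χ u else 0 := by
    rw [← zc_sum_units n (fun x => if ZMod.castHom hm (ZMod m) x = 1 then χ x else 0)]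
    refine Finset.sum_congr rfl fun a ha => ?_
    simp only [Finset.mem_filter, Finset.mem_Icc] at ha
    have : m ∣ a - 1 ↔ ZMod.castHom hm (ZMod m) (a : ZMod n) = 1 := by
      rw [map_natCast, ← ZMod.natCast_eq_zero_iff, Nat.cast_sub ha.1.1, sub_eq_zero, Nat.cast_one]
    simp only [this]
  have h2 : (∑ u : (ZMod n)ˣ, if ZMod.castHom hm (ZMod m) (u : ZMod n) = 1 then χ u else 0)
      = ∑ u : K, χ ((u : (ZMod n)ˣ) : ZMod n) := by
    rw [← Finset.sum_filter]
    refine Finset.sum_subtype _ (fun u => ?_) (fun u : (ZMod n)ˣ => χ (u : ZMod n))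
    simp only [Finset.mem_filter, Finset.mem_univ, true_and, K, MonoidHom.mem_ker, Units.ext_iff]
    rfl
  let f : K →* ℂ := (χ : ZMod n →* ℂ).comp ((Units.coeHom (ZMod n)).comp K.subtype)
  have h3 : ∑ u : K, χ ((u : (ZMod n)ˣ) : ZMod n) = ((if f = 1 then Fintype.card K else 0 : ℕ) : ℂ) :=
    sum_hom_units f
  have h4 : f = 1 ↔ χ.conductor ∣ m := by
    rw [← DirichletCharacter.mem_conductorSet_iff_conductor_dvd χ hm,
      DirichletCharacter.mem_conductorSet_iff,
      DirichletCharacter.factorsThrough_iff_ker_unitsMap hm]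
    constructor
    · intro h u hu
      have := DFunLike.congr_fun h ⟨u, hu⟩
      rw [MonoidHom.mem_ker]
      apply Units.ext
      simpa [f] using this
    · intro h
      ext ⟨u, hu⟩
      have := congrArg Units.val (MonoidHom.mem_ker.1 (h hu))
      simpa [f] using this
  have h5 : Nat.totient m * Fintype.card K = Nat.totient n := by
    have h := K.card_mul_index
    rw [Subgroup.index_ker, MonoidHom.range_eq_top.2 (ZMod.unitsMap_surjective hm),
      Subgroup.card_top, Nat.card_eq_fintype_card, Nat.card_eq_fintype_card,
      Nat.card_eq_fintype_card, ZMod.card_units_eq_totient, ZMod.card_units_eq_totient] at h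
    rw [mul_comm]
    exact h
  rw [h1, h2, h3]
  simp only [h4]
  split_ifs
  · rw [← h5]; push_cast; rfl
  · simp

/-- Zhao–Cao's identity. -/
theorem zhao_cao_identity (n : ℕ) (hn : 0 < n)
    (χ : DirichletCharacter ℂ n) (d : ℕ) (hd : χ.conductor = d) :
    ∑ a ∈ (Finset.Icc 1 n).filter (fun a => Nat.Coprime a n),
      (Nat.gcd (a - 1) n : ℂ) * χ (a : ZMod n)
    = (Nat.totient n : ℂ) * ((n / d).divisors.card : ℂ) := by
  have : NeZero n := ⟨hn.ne'⟩
  have key : ∀ a : ℕ, (Nat.gcd (a - 1) n : ℂ) * χ (a : ZMod n) =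
      ∑ m ∈ n.divisors, (Nat.totient m : ℂ) * (if m ∣ a - 1 then χ (a : ZMod n) else 0) := by
    intro a
    have h : (Nat.gcd (a - 1) n).divisors = n.divisors.filter (fun m => m ∣ a - 1) := by
      ext m
      simp only [Nat.mem_divisors, Finset.mem_filter, Nat.dvd_gcd_iff]
      have : Nat.gcd (a - 1) n ≠ 0 := (Nat.gcd_pos_of_pos_right _ hn).ne'
      have := hn.ne'
      tauto
    conv_lhs => rw [← Nat.sum_totient (Nat.gcd (a - 1) n), h]
    push_cast
    rw [Finset.sum_mul, Finset.sum_filter]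
    refine Finset.sum_congr rfl fun m _ => ?_
    split_ifs <;> simp
  simp only [key]
  rw [Finset.sum_comm]
  have h2 : ∀ m ∈ n.divisors, ∑ a ∈ (Finset.Icc 1 n).filter (fun a => Nat.Coprime a n),
      (Nat.totient m : ℂ) * (if m ∣ a - 1 then χ (a : ZMod n) else 0) =
      if d ∣ m then (Nat.totient n : ℂ) else 0 := by
    intro m hm
    rw [← Finset.mul_sum, zc_inner n χ m (Nat.dvd_of_mem_divisors hm), hd]
  rw [Finset.sum_congr rfl h2, ← Finset.sum_filter, Finset.sum_const, nsmul_eq_mul, mul_comm]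
  congr 2
  have hdn : d ∣ n := hd ▸ χ.conductor_dvd_level
  obtain ⟨k, rfl⟩ := hdn
  have hd0 : 0 < d := Nat.pos_of_mul_pos_right hn
  have hk0 : 0 < k := Nat.pos_of_mul_pos_left hn
  rw [Nat.mul_div_cancel_left _ hd0]
  symm
  refine Finset.card_bij (fun e _ => d * e) ?_ ?_ ?_
  · intro e he
    rw [Finset.mem_filter, Nat.mem_divisors]
    exact ⟨⟨Nat.mul_dvd_mul_left d (Nat.dvd_of_mem_divisors he), hn.ne'⟩, dvd_mul_right _ _⟩
  · intro a _ b _ h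
    exact Nat.eq_of_mul_eq_mul_left hd0 h
  · intro m hm
    rw [Finset.mem_filter, Nat.mem_divisors] at hm
    obtain ⟨⟨h, _⟩, e, rfl⟩ := hm
    exact ⟨e, Nat.mem_divisors.2 ⟨Nat.dvd_of_mul_dvd_mul_left hd0 h, hk0.ne'⟩, rfl⟩
end

section
/- Let n be a positive integer, r ≥ 0 an integer, and χ a Dirichlet character modulo n with conductor d. Then ∑ gcd(a−1, b₁, …, b_r, n)·χ(a), where a ranges over integers in [1,n] coprime to n and b₁, …, b_r range over integers in [1,n], equals φ(n)·σ_r(n/d) (Li–Hu–Kim's identity). -/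
open Finset

lemma lhk_gcd (n r a : ℕ) (hn : 0 < n) (b : Fin r → ℕ) :
    (Nat.gcd (a - 1) (Nat.gcd (Finset.univ.gcd fun j => b j) n) : ℂ) =
      ∑ e ∈ n.divisors, (Nat.totient e : ℂ) * (if e ∣ a - 1 then 1 else 0) *
        (if ∀ j, e ∣ b j then 1 else 0) := by
  conv_lhs => rw [← Nat.sum_totient (Nat.gcd (a - 1) (Nat.gcd (Finset.univ.gcd fun j => b j) n))]
  have h : (Nat.gcd (a - 1) (Nat.gcd (Finset.univ.gcd fun j => b j) n)).divisors
      = n.divisors.filter (fun e => e ∣ a - 1 ∧ ∀ j, e ∣ b j) := by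
    ext e
    simp only [Nat.mem_divisors, Finset.mem_filter, Nat.dvd_gcd_iff, Finset.dvd_gcd_iff,
      Finset.mem_univ, true_imp_iff]
    constructor
    · rintro ⟨⟨h1, h2, h3⟩, -⟩
      exact ⟨⟨h3, hn.ne'⟩, h1, h2⟩
    · rintro ⟨⟨h3, -⟩, h1, h2⟩
      refine ⟨⟨h1, h2, h3⟩, ?_⟩
      exact (Nat.gcd_pos_of_pos_right _ (Nat.gcd_pos_of_pos_right _ hn)).ne'
  rw [h, Finset.sum_filter, Nat.cast_sum]
  refine Finset.sum_congr rfl fun e _ => ?_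
  by_cases h1 : e ∣ a - 1 <;> by_cases h2 : ∀ j, e ∣ b j <;> simp [h1, h2]

lemma lhk_count (n r e : ℕ) :
    ∑ b ∈ Fintype.piFinset (fun _ : Fin r => Finset.Icc 1 n),
      (if ∀ j, e ∣ b j then (1 : ℂ) else 0) = ((n / e : ℕ) : ℂ) ^ r := by
  rw [Finset.sum_boole]
  have h : (Fintype.piFinset (fun _ : Fin r => Finset.Icc 1 n)).filter (fun b => ∀ j, e ∣ b j)
      = Fintype.piFinset (fun _ : Fin r => (Finset.Icc 1 n).filter (fun x => e ∣ x)) := by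
    ext b
    simp only [Finset.mem_filter, Fintype.mem_piFinset]
    exact forall_and.symm
  have h2 : ((Finset.Icc 1 n).filter (fun x => e ∣ x)).card = n / e :=
    Nat.Ioc_filter_dvd_card_eq_div n e
  rw [h, Fintype.card_piFinset]
  simp [h2]

lemma lhk_units (n : ℕ) [NeZero n] (f : ℕ → ℂ) (g : (ZMod n)ˣ → ℂ)
    (hfg : ∀ a, 1 ≤ a → ∀ h : Nat.Coprime a n, f a = g (ZMod.unitOfCoprime a h)) :
    ∑ a ∈ (Finset.Icc 1 n).filter (fun a => Nat.Coprime a n), f a = ∑ u, g u := by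
  refine Finset.sum_bij (fun a ha => ZMod.unitOfCoprime a (Finset.mem_filter.1 ha).2)
    (fun _ _ => Finset.mem_univ _) ?_ ?_ ?_
  · intro a ha b hb hab
    have h := congrArg (fun u : (ZMod n)ˣ => (u : ZMod n)) hab
    simp only [ZMod.coe_unitOfCoprime] at h
    simp only [Finset.mem_filter, Finset.mem_Icc] at ha hb
    have h2 : a ≡ b [MOD n] := (ZMod.natCast_eq_natCast_iff _ _ _).1 h
    have h3 : (n : ℤ) ∣ (b : ℤ) - a := (Nat.modEq_iff_dvd).1 h2
    have h4 : |(b : ℤ) - a| < n := by rw [abs_lt]; constructor <;> omega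
    have := Int.eq_zero_of_abs_lt_dvd h3 h4
    omega
  · intro u _
    have hlt := ZMod.val_lt (u : ZMod n)
    have hc := ZMod.val_coe_unit_coprime u
    by_cases h0 : (u : ZMod n).val = 0
    · rw [h0] at hc
      have h1 : n = 1 := by simpa using hc
      refine ⟨n, ?_, ?_⟩
      · simp [h1]
      · subst h1
        exact Subsingleton.elim _ _
    · refine ⟨(u : ZMod n).val, ?_, ?_⟩
      · simp only [Finset.mem_filter, Finset.mem_Icc]
        exact ⟨by omega, hc⟩
      · ext
        simp
  · intro a ha
    exact hfg a (Finset.mem_Icc.1 (Finset.mem_filter.1 ha).1).1 _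

lemma lhk_inner (n e : ℕ) [NeZero n] (he : e ∣ n) (χ : DirichletCharacter ℂ n) :
    (Nat.totient e : ℂ) * ∑ a ∈ (Finset.Icc 1 n).filter (fun a => Nat.Coprime a n),
      (if e ∣ a - 1 then (1 : ℂ) else 0) * χ (a : ZMod n)
    = if χ.conductor ∣ e then (Nat.totient n : ℂ) else 0 := by
  classical
  haveI : NeZero e := ⟨fun h => NeZero.ne n (by subst h; simpa using he)⟩
  have key := lhk_units n (fun a => (if e ∣ a - 1 then (1 : ℂ) else 0) * χ (a : ZMod n))
    (fun u => if u ∈ (ZMod.unitsMap he).ker then χ (u : ZMod n) else 0) (by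
      intro a ha h
      have : e ∣ a - 1 ↔ ZMod.unitOfCoprime a h ∈ (ZMod.unitsMap he).ker := by
        rw [MonoidHom.mem_ker, ← Units.val_inj, ZMod.unitsMap_def, Units.coe_map]
        simp only [ZMod.coe_unitOfCoprime, MonoidHom.coe_coe, map_natCast, Units.val_one]
        rw [← ZMod.natCast_eq_zero_iff, Nat.cast_sub ha, Nat.cast_one, sub_eq_zero]
      by_cases h1 : e ∣ a - 1
      · simp [h1, this.1 h1]
      · have h2 := fun h' => h1 (this.2 h')
        rw [if_neg h1, if_neg h2, zero_mul])
  rw [key, ← Finset.sum_filter]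
  set K := (ZMod.unitsMap he).ker with hK
  let f : K →* ℂ := (Units.coeHom ℂ).comp (χ.toUnitHom.comp K.subtype)
  have hs : ∑ u ∈ Finset.univ.filter (fun u => u ∈ K), χ (u : ZMod n) = ∑ g : K, f g := by
    rw [Finset.sum_subtype (p := fun u => u ∈ K) _ (by simp)]
    refine Finset.sum_congr rfl fun g _ => ?_
    simp [f]
  have hf : f = 1 ↔ χ.conductor ∣ e := by
    rw [← DirichletCharacter.mem_conductorSet_iff_conductor_dvd χ he,
      DirichletCharacter.mem_conductorSet_iff, DirichletCharacter.factorsThrough_iff_ker_unitsMap he]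
    constructor
    · intro h u hu
      have := DFunLike.congr_fun h ⟨u, hu⟩
      rw [MonoidHom.mem_ker]
      ext
      simpa [f] using this
    · intro h
      ext ⟨u, hu⟩
      have := h hu
      rw [MonoidHom.mem_ker] at this
      simp only [f, MonoidHom.comp_apply, Subgroup.coe_subtype, MonoidHom.one_apply]
      rw [this]
      simp
  have hc : Nat.totient e * Fintype.card K = Nat.totient n := by
    have h := K.card_mul_index
    rw [hK, Subgroup.index_ker, MonoidHom.range_eq_top.2 (ZMod.unitsMap_surjective he),
      Subgroup.card_top, Nat.card_eq_fintype_card, Nat.card_eq_fintype_card,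
      Nat.card_eq_fintype_card, ZMod.card_units_eq_totient, ZMod.card_units_eq_totient] at h
    rw [mul_comm]
    convert! h
  rw [hs, sum_hom_units, ← hc]
  by_cases h : f = 1
  · rw [if_pos h, if_pos (hf.1 h)]; push_cast; rfl
  · rw [if_neg h, if_neg (fun h' => h (hf.2 h'))]; simp

/-- Li–Hu–Kim's identity. -/
theorem li_hu_kim_identity (n r : ℕ) (hn : 0 < n)
    (χ : DirichletCharacter ℂ n) (d : ℕ) (hd : χ.conductor = d) :
    ∑ a ∈ (Finset.Icc 1 n).filter (fun a => Nat.Coprime a n),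
      ∑ b ∈ Fintype.piFinset (fun _ : Fin r => Finset.Icc 1 n),
        (Nat.gcd (a - 1) (Nat.gcd (Finset.univ.gcd fun j => b j) n) : ℂ) * χ (a : ZMod n)
    = (Nat.totient n : ℂ) * ∑ e ∈ (n / d).divisors, (e : ℂ) ^ r := by
  haveI : NeZero n := ⟨hn.ne'⟩
  have hdn : d ∣ n := hd ▸ χ.conductor_dvd_level
  have hd0 : 0 < d := Nat.pos_of_dvd_of_pos hdn hn
  have h1 : ∑ a ∈ (Finset.Icc 1 n).filter (fun a => Nat.Coprime a n),
      ∑ b ∈ Fintype.piFinset (fun _ : Fin r => Finset.Icc 1 n),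
        (Nat.gcd (a - 1) (Nat.gcd (Finset.univ.gcd fun j => b j) n) : ℂ) * χ (a : ZMod n)
      = ∑ e ∈ n.divisors, ((Nat.totient e : ℂ) *
          ∑ a ∈ (Finset.Icc 1 n).filter (fun a => Nat.Coprime a n),
            (if e ∣ a - 1 then (1 : ℂ) else 0) * χ (a : ZMod n)) * ((n / e : ℕ) : ℂ) ^ r := by
    simp_rw [lhk_gcd n r _ hn, Finset.sum_mul]
    have hR : ∀ e ∈ n.divisors, ((Nat.totient e : ℂ) *
          ∑ a ∈ (Finset.Icc 1 n).filter (fun a => Nat.Coprime a n),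
            (if e ∣ a - 1 then (1 : ℂ) else 0) * χ (a : ZMod n)) * ((n / e : ℕ) : ℂ) ^ r
        = ∑ a ∈ (Finset.Icc 1 n).filter (fun a => Nat.Coprime a n),
          ∑ b ∈ Fintype.piFinset (fun _ : Fin r => Finset.Icc 1 n),
            (Nat.totient e : ℂ) * (if e ∣ a - 1 then 1 else 0) *
              (if ∀ j, e ∣ b j then 1 else 0) * χ (a : ZMod n) := by
      intro e _
      rw [Finset.mul_sum, Finset.sum_mul, ← lhk_count n r]
      refine Finset.sum_congr rfl fun a _ => ?_
      rw [Finset.mul_sum]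
      refine Finset.sum_congr rfl fun b _ => ?_
      ring
    rw [Finset.sum_congr rfl hR, Finset.sum_comm (s := n.divisors)]
    refine Finset.sum_congr rfl fun a _ => ?_
    rw [Finset.sum_comm]
  rw [h1]
  have h2 : ∀ e ∈ n.divisors, ((Nat.totient e : ℂ) *
          ∑ a ∈ (Finset.Icc 1 n).filter (fun a => Nat.Coprime a n),
            (if e ∣ a - 1 then (1 : ℂ) else 0) * χ (a : ZMod n)) * ((n / e : ℕ) : ℂ) ^ r
      = if d ∣ e then (Nat.totient n : ℂ) * ((n / e : ℕ) : ℂ) ^ r else 0 := by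
    intro e he
    rw [lhk_inner n e (Nat.dvd_of_mem_divisors he) χ, hd]
    split_ifs <;> simp
  rw [Finset.sum_congr rfl h2, ← Finset.sum_filter, ← Finset.mul_sum]
  congr 1
  obtain ⟨k, rfl⟩ := hdn
  have hk : 0 < k := Nat.pos_of_mul_pos_left hn
  rw [Nat.mul_div_cancel_left k hd0, ← Nat.sum_div_divisors k (fun e => (e : ℂ) ^ r)]
  symm
  refine Finset.sum_bij (fun e _ => d * e) ?_ ?_ ?_ ?_
  · intro e he
    simp only [Finset.mem_filter, Nat.mem_divisors] at he ⊢
    exact ⟨⟨Nat.mul_dvd_mul_left d he.1, hn.ne'⟩, dvd_mul_right _ _⟩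
  · intro a _ b _ h
    exact Nat.eq_of_mul_eq_mul_left hd0 h
  · intro e he
    simp only [Finset.mem_filter, Nat.mem_divisors] at he
    obtain ⟨⟨h3, -⟩, m, rfl⟩ := he
    exact ⟨m, Nat.mem_divisors.2 ⟨Nat.dvd_of_mul_dvd_mul_left hd0 h3, hk.ne'⟩, rfl⟩
  · intro e _
    rw [Nat.mul_div_mul_left _ _ hd0]
end
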